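/- arXiv:1407.7007 — 2 statements merged into one kernel-verified Lean document; each statement's English description precedes it below -/
import Mathlib

section
/- Let p, q be relatively prime positive integers, {L_n} the (p,q)-Lucas sequence, and let a, d be positive integers and n ≥ 3. Set d_i = L_{a + (i−1)·d} for 1 ≤ i ≤ n and A = {d_1, …, d_n}. Then the toric ideal I_A is a complete intersection if and only if one of the following holds: (a) d is odd; (b) d ≥ a; (c) gcd(a, d) = a − d and the 2-adic valuation of d is strictly greater than the 2-adic valuation of a, which is at least 1; (d) n = 3, d divides a, a/d and p are odd, and q is even; or (e) n = 3, d divides a, 3 does not divide d, and p, q and a/d are all odd. -/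
open MvPolynomial

/-- The `(p,q)`-Fibonacci sequence: `F 0 = 0`, `F 1 = 1`, `F (n+2) = p * F (n+1) + q * F n`. -/
def pqFib (p q : ℕ) : ℕ → ℕ
  | 0 => 0
  | 1 => 1
  | n + 2 => p * pqFib p q (n + 1) + q * pqFib p q n

/-- The `(p,q)`-Lucas sequence: `L 0 = 2`, `L 1 = p`, `L (n+2) = p * L (n+1) + q * L n`. -/
def pqLucas (p q : ℕ) : ℕ → ℕ
  | 0 => 2
  | 1 => p
  | n + 2 => p * pqLucas p q (n + 1) + q * pqLucas p q n

/-- The toric ideal of the affine monomial curve `t ↦ (t^{d 0}, …, t^{d (n-1)})`: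
the kernel of the `k`-algebra map `k[x_1,…,x_n] → k[t]`, `x_i ↦ t^{d i}`. -/
noncomputable def toricIdeal (k : Type*) [Field k] {n : ℕ} (d : Fin n → ℕ) :
    Ideal (MvPolynomial (Fin n) k) :=
  RingHom.ker (MvPolynomial.aeval
    (fun i : Fin n => (Polynomial.X : Polynomial k) ^ d i)).toRingHom

/-- The toric ideal `I_A` is a complete intersection iff it can be generated by
`n - 1` elements. -/
def IsCI (k : Type*) [Field k] {n : ℕ} (d : Fin n → ℕ) : Prop :=
  ∃ g : Fin (n - 1) → MvPolynomial (Fin n) k,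
    Ideal.span (Set.range g) = toricIdeal k d

/-- The toric ideal of the projective monomial curve: the kernel of the `k`-algebra map
`k[x_1,…,x_{n+1}] → k[t,u]`, `x_i ↦ t^{d i} u^{D - d i}` for `i ≤ n` and
`x_{n+1} ↦ u^D`, where `D = max A`. -/
noncomputable def projToricIdeal (k : Type*) [Field k] {n : ℕ} (d : Fin n → ℕ) :
    Ideal (MvPolynomial (Fin (n + 1)) k) :=
  RingHom.ker (MvPolynomial.aeval (fun i : Fin (n + 1) =>
    if h : (i : ℕ) < n then
      (X 0 : MvPolynomial (Fin 2) k) ^ d ⟨i, h⟩ *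
        (X 1 : MvPolynomial (Fin 2) k) ^ (Finset.univ.sup d - d ⟨i, h⟩)
    else (X 1 : MvPolynomial (Fin 2) k) ^ (Finset.univ.sup d))).toRingHom

/-- The projective toric ideal `I_{A*}` is a complete intersection iff it can be
generated by `n - 1` elements. -/
def ProjIsCI (k : Type*) [Field k] {n : ℕ} (d : Fin n → ℕ) : Prop :=
  ∃ g : Fin (n - 1) → MvPolynomial (Fin (n + 1)) k,
    Ideal.span (Set.range g) = projToricIdeal k d

/-- `d 0 < d 1 < ⋯` is a generalized arithmetic sequence: there are positive
integers `h, e` with `d i = h * d 0 + i * e` for every `i ≥ 1`. -/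
def IsGenArith {n : ℕ} (d : Fin n → ℕ) : Prop :=
  ∃ h e : ℕ, 0 < h ∧ 0 < e ∧
    ∀ i : Fin n, 0 < (i : ℕ) → d i = h * d ⟨0, i.pos⟩ + (i : ℕ) * e

/-- `d 0 < d 1 < ⋯` is an increasing arithmetic sequence: there is a positive
integer `e` with `d i = d 0 + i * e` for every `i`. -/
def IsArithFn {n : ℕ} (d : Fin n → ℕ) : Prop :=
  ∃ e : ℕ, 0 < e ∧ ∀ i : Fin n, 0 < (i : ℕ) → d i = d ⟨0, i.pos⟩ + (i : ℕ) * e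

/-- `A = {d 0, …, d (n-1)}` minimally generates the numerical semigroup
`ℕ d 0 + ⋯ + ℕ d (n-1)`: no `d i` lies in the subsemigroup generated by the rest. -/
def MinimallyGenerates {n : ℕ} (d : Fin n → ℕ) : Prop :=
  ∀ i : Fin n, ¬ ∃ α : Fin n → ℕ, α i = 0 ∧ d i = ∑ j, α j * d j


def wt {n : ℕ} (d : Fin n → ℕ) (m : Fin n →₀ ℕ) : ℕ := ∑ i, m i * d i

lemma wt_add {n : ℕ} (d : Fin n → ℕ) (m m' : Fin n →₀ ℕ) : wt d (m + m') = wt d m + wt d m' := by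
  simp [wt, add_mul, Finset.sum_add_distrib]

lemma wt_single {n : ℕ} (d : Fin n → ℕ) (i : Fin n) (c : ℕ) :
    wt d (Finsupp.single i c) = c * d i := by
  unfold wt
  rw [Finset.sum_eq_single i]
  · simp
  · intro b _ hb; rw [Finsupp.single_eq_of_ne hb]; simp
  · simp

lemma wt_zero {n : ℕ} (d : Fin n → ℕ) : wt d 0 = 0 := by simp [wt]

lemma wt_pos {n : ℕ} (d : Fin n → ℕ) (hd : ∀ i, 0 < d i) (m : Fin n →₀ ℕ) (hm : m ≠ 0) :
    0 < wt d m := by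
  obtain ⟨i, hi⟩ := Finsupp.ne_iff.mp hm
  have h1 : m i * d i ≤ wt d m :=
    Finset.single_le_sum (f := fun i => m i * d i) (fun _ _ => Nat.zero_le _) (Finset.mem_univ i)
  have : 0 < m i * d i := Nat.mul_pos (Nat.pos_of_ne_zero (by simpa using hi)) (hd i)
  omega

section alg
variable {k : Type*} [Field k] {n : ℕ}

lemma aeval_mono (d : Fin n → ℕ) (m : Fin n →₀ ℕ) (c : k) :
    aeval (fun i : Fin n => (Polynomial.X : Polynomial k) ^ d i) (monomial m c)
      = Polynomial.monomial (wt d m) c := by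
  rw [aeval_monomial, Finsupp.prod_fintype _ _ (by simp)]
  simp only [← pow_mul]
  rw [Finset.prod_pow_eq_pow_sum, ← Polynomial.C_mul_X_pow_eq_monomial]
  simp [wt, mul_comm, Polynomial.algebraMap_eq]

lemma mem_toric_iff (d : Fin n → ℕ) (f : MvPolynomial (Fin n) k) :
    f ∈ toricIdeal k d ↔ aeval (fun i : Fin n => (Polynomial.X : Polynomial k) ^ d i) f = 0 := by
  simp only [toricIdeal, RingHom.mem_ker]; rfl

lemma aeval_eq_sum (d : Fin n → ℕ) (f : MvPolynomial (Fin n) k) :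
    aeval (fun i : Fin n => (Polynomial.X : Polynomial k) ^ d i) f
      = ∑ m ∈ f.support, Polynomial.monomial (wt d m) (coeff m f) := by
  conv_lhs => rw [f.as_sum, map_sum]
  exact Finset.sum_congr rfl fun m _ => aeval_mono d m _

lemma binom_mem (d : Fin n → ℕ) (m m' : Fin n →₀ ℕ) (h : wt d m = wt d m') :
    (monomial m (1 : k) - monomial m' 1) ∈ toricIdeal k d := by
  rw [mem_toric_iff, map_sub, aeval_mono, aeval_mono, h, sub_self]

/-- a monomial alone in its fibre has zero coefficient -/
lemma coeff_zero_of_alone (d : Fin n → ℕ) (f : MvPolynomial (Fin n) k) (hf : f ∈ toricIdeal k d)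
    (m : Fin n →₀ ℕ) (h : ∀ m', wt d m' = wt d m → m' = m) : coeff m f = 0 := by
  rw [mem_toric_iff, aeval_eq_sum] at hf
  have := congrArg (fun P => Polynomial.coeff P (wt d m)) hf
  simp only [Polynomial.finsetSum_coeff, Polynomial.coeff_monomial, Polynomial.coeff_zero] at this
  by_cases hm : m ∈ f.support
  · rw [Finset.sum_eq_single m] at this
    · simpa using this
    · intro b _ hb
      rw [if_neg]; intro hh; exact hb (h b hh)
    · intro h; exact absurd hm h
  · simpa using hm

def Iso (d : Fin n → ℕ) (m : Fin n →₀ ℕ) : Prop :=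
  ∀ m', wt d m' = wt d m → m' ≠ m → ∀ l, m l = 0 ∨ m' l = 0

lemma iso_kill (d : Fin n → ℕ) (m : Fin n →₀ ℕ) (hm : Iso d m) (l : Fin n)
    (h : MvPolynomial (Fin n) k) (hh : h ∈ toricIdeal k d) : coeff m (X l * h) = 0 := by
  classical
  rw [coeff_X_mul']
  split_ifs with hl
  · have hl' : m l ≠ 0 := by simpa using hl
    have hle : Finsupp.single l 1 ≤ m := by
      rw [Finsupp.single_le_iff]; omega
    have hadd : m - Finsupp.single l 1 + Finsupp.single l 1 = m := tsub_add_cancel_of_le hle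
    apply coeff_zero_of_alone d h hh
    intro m' hw
    by_contra hne
    have := hm (m' + Finsupp.single l 1) (by rw [wt_add, hw, ← wt_add, hadd]) (by
      intro hc
      apply hne
      rw [← hc]; simp) l
    simp at this
    exact hl' this
  · rfl

def NCI (k : Type*) [Field k] {n : ℕ} (d : Fin n → ℕ) : Prop :=
  ∃ Φ : MvPolynomial (Fin n) k →ₗ[k] (Fin n → k),
    (∀ l, ∀ h ∈ toricIdeal k d, Φ (X l * h) = 0) ∧ ∀ v, ∃ f ∈ toricIdeal k d, Φ f = v

lemma kill_mul (d : Fin n → ℕ) (Φ : MvPolynomial (Fin n) k →ₗ[k] (Fin n → k))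
    (hΦ : ∀ l, ∀ h ∈ toricIdeal k d, Φ (X l * h) = 0) (g h : MvPolynomial (Fin n) k)
    (hh : h ∈ toricIdeal k d) : Φ (g * h) = constantCoeff g • Φ h := by
  induction g using MvPolynomial.induction_on with
  | C a => simp [C_mul']
  | add p q hp hq => rw [add_mul, map_add, hp, hq, map_add, add_smul]
  | mul_X p l hp =>
    have : p * X l * h = X l * (p * h) := by ring
    rw [this, hΦ l _ (Ideal.mul_mem_left _ _ hh)]
    simp

lemma not_IsCI_of_NCI (d : Fin n → ℕ) (hn : 1 ≤ n) (h : NCI k d) : ¬ IsCI k d := by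
  rintro ⟨g, hg⟩
  obtain ⟨Φ, hk, hs⟩ := h
  have hgm : ∀ l, g l ∈ toricIdeal k d := fun l => hg ▸ Ideal.subset_span ⟨l, rfl⟩
  have key : ∀ v, v ∈ Submodule.span k (Set.range fun l => Φ (g l)) := by
    intro v
    obtain ⟨f, hf, rfl⟩ := hs v
    rw [← hg] at hf
    obtain ⟨c, rfl⟩ := (Ideal.mem_span_range_iff_exists_fun).mp hf
    rw [map_sum]
    refine Submodule.sum_mem _ fun l _ => ?_
    rw [kill_mul d Φ hk _ _ (hgm l)]
    exact Submodule.smul_mem _ _ (Submodule.subset_span ⟨l, rfl⟩)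
  have h1 := finrank_range_le_card (R := k) (fun l => Φ (g l))
  have h2 : Submodule.span k (Set.range fun l => Φ (g l)) = ⊤ := by
    rw [eq_top_iff]; intro v _; exact key v
  unfold Set.finrank at h1
  rw [h2, finrank_top] at h1
  simp at h1
  omega

lemma NCI_of_comb (d : Fin n → ℕ) (M w : Fin n → (Fin n →₀ ℕ)) (ρ : Fin n → ℕ)
    (hM : Function.Injective M) (hiso : ∀ i, Iso d (M i)) (hw : ∀ i, wt d (w i) = wt d (M i))
    (hρ : ∀ i j, w i = M j → ρ j < ρ i) : NCI k d := by
  classical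
  let Φ : MvPolynomial (Fin n) k →ₗ[k] (Fin n → k) := LinearMap.pi fun i => lcoeff k (M i)
  have hΦ : ∀ f i, Φ f i = coeff (M i) f := fun f i => rfl
  refine ⟨Φ, ?_, ?_⟩
  · intro l h hh
    ext i
    rw [hΦ]
    exact iso_kill d _ (hiso i) l h hh
  · have key : ∀ r, ∀ i, ρ i = r → ∃ f ∈ toricIdeal k d, Φ f = Pi.single i 1 := by
      intro r
      induction r using Nat.strong_induction_on with
      | _ r ih =>
        intro i hi
        have hb := binom_mem (k := k) d (M i) (w i) (hw i).symm
        by_cases hj : ∃ j, w i = M j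
        · obtain ⟨j, hj⟩ := hj
          obtain ⟨f, hf, hf2⟩ := ih (ρ j) (hi ▸ hρ i j hj) j rfl
          refine ⟨_, Ideal.add_mem _ hb hf, ?_⟩
          rw [map_add, hf2]
          ext l
          rw [Pi.add_apply, hΦ, coeff_sub, coeff_monomial, coeff_monomial, hj]
          simp only [hM.eq_iff, Pi.single_apply, eq_comm (a := l)]
          ring
        · refine ⟨_, hb, ?_⟩
          ext l
          rw [hΦ, coeff_sub, coeff_monomial, coeff_monomial]
          rw [if_neg (fun h => hj ⟨l, h⟩)]
          simp only [hM.eq_iff, Pi.single_apply, eq_comm (a := l), sub_zero]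
    choose f hf hf2 using fun i => key _ i rfl
    intro v
    refine ⟨∑ i, v i • f i, Ideal.sum_mem _ fun i _ => ?_, ?_⟩
    · rw [smul_eq_C_mul]; exact Ideal.mul_mem_left _ _ (hf i)
    · rw [map_sum]
      simp only [map_smul, hf2]
      ext l
      simp [Finset.sum_apply, Pi.single_apply]

lemma NCI_succ (d : Fin (n + 1) → ℕ) (w : Fin n →₀ ℕ)
    (hpos : ∀ i, 0 < d i) (hw : wt (fun i : Fin n => d i.castSucc) w = d (Fin.last n))
    (h : NCI k (fun i : Fin n => d i.castSucc)) : NCI k d := by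
  classical
  obtain ⟨Φ, hk, hs⟩ := h
  set d' : Fin n → ℕ := fun i : Fin n => d i.castSucc with hd'
  let π : MvPolynomial (Fin (n + 1)) k →ₐ[k] MvPolynomial (Fin n) k :=
    aeval (Fin.lastCases (monomial w (1 : k)) (fun i => X i))
  have π1 : π (X (Fin.last n)) = monomial w 1 := by simp [π]
  have π2 : ∀ i : Fin n, π (X i.castSucc) = X i := by intro i; simp [π]
  let ι : MvPolynomial (Fin n) k →ₐ[k] MvPolynomial (Fin (n + 1)) k := rename Fin.castSucc
  have πι : ∀ f, π (ι f) = f := by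
    intro f
    have : π.comp ι = AlgHom.id k _ := by
      apply MvPolynomial.algHom_ext
      intro i
      simp only [AlgHom.comp_apply, ι, rename_X, π2, AlgHom.id_apply]
    exact DFunLike.congr_fun this f
  have hπI : ∀ f ∈ toricIdeal k d, π f ∈ toricIdeal k d' := by
    intro f hf
    rw [mem_toric_iff] at hf ⊢
    rw [← hf]
    have : (aeval (fun i : Fin n => (Polynomial.X : Polynomial k) ^ d' i)).comp π =
        aeval (fun i : Fin (n+1) => (Polynomial.X : Polynomial k) ^ d i) := by
      apply MvPolynomial.algHom_ext
      intro i
      refine Fin.lastCases ?_ (fun i => ?_) i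
      · rw [AlgHom.comp_apply, π1, aeval_mono, hw, aeval_X, Polynomial.X_pow_eq_monomial]
      · rw [AlgHom.comp_apply, π2, aeval_X, aeval_X]
    exact DFunLike.congr_fun this f
  have hιI : ∀ f ∈ toricIdeal k d', ι f ∈ toricIdeal k d := by
    intro f hf
    rw [mem_toric_iff] at hf ⊢
    rw [← hf]
    simp only [ι, aeval_rename]
    rfl
  have hw0 : w ≠ 0 := by rintro rfl; rw [wt_zero] at hw; have := hpos (Fin.last n); omega
  have hconst : ∀ f ∈ toricIdeal k d, coeff 0 f = 0 := by
    intro f hf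
    apply coeff_zero_of_alone d f hf
    intro m' hm'
    by_contra hne
    have := wt_pos d hpos m' hne
    rw [wt_zero] at hm'; omega
  let Λ : MvPolynomial (Fin (n + 1)) k →ₗ[k] k := lcoeff k (Finsupp.single (Fin.last n) 1)
  have hΛ : ∀ f, Λ f = coeff (Finsupp.single (Fin.last n) 1) f := fun f => rfl
  have hconst2 : ∀ f ∈ toricIdeal k d, ∀ l, Λ (X l * f) = 0 := by
    intro f hf l
    rw [hΛ, coeff_X_mul']
    split_ifs with hl
    · have : l = Fin.last n := by
        rw [Finsupp.mem_support_iff, Finsupp.single_apply] at hl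
        by_contra hne
        exact hl (if_neg fun h => hne h.symm)
      subst this
      rw [tsub_self]
      exact hconst f hf
    · rfl
  refine ⟨LinearMap.pi (Fin.lastCases Λ fun i => (LinearMap.proj i).comp (Φ.comp π.toLinearMap)), ?_, ?_⟩
  · intro l h hh
    ext i
    rw [LinearMap.pi_apply]
    refine Fin.lastCases ?_ (fun i => ?_) i
    · simpa using hconst2 h hh l
    · simp only [Fin.lastCases_castSucc, LinearMap.comp_apply, AlgHom.toLinearMap_apply, map_mul]
      rw [LinearMap.proj_apply]
      refine Fin.lastCases ?_ (fun l => ?_) l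
      · rw [π1, kill_mul d' Φ hk _ _ (hπI h hh), constantCoeff_monomial, if_neg hw0]
        simp
      · rw [π2, hk l _ (hπI h hh)]; rfl
  · intro v
    obtain ⟨f0, hf0, hf1⟩ := hs (fun i => v i.castSucc)
    have hB : (X (Fin.last n) - ι (monomial w 1)) ∈ toricIdeal k d := by
      rw [mem_toric_iff, map_sub]
      simp only [ι, aeval_rename, aeval_X]
      rw [sub_eq_zero, Polynomial.X_pow_eq_monomial, ← hw]
      exact (aeval_mono d' w 1).symm
    have hΛι : ∀ f, Λ (ι f) = 0 := by
      intro f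
      rw [hΛ]
      apply coeff_rename_eq_zero
      intro u hu
      exfalso
      have := DFunLike.congr_fun hu (Fin.last n)
      rw [Finsupp.mapDomain_of_notMem_range] at this
      · simp at this
      · rintro ⟨i, hi⟩
        exact absurd hi (Fin.castSucc_lt_last i).ne
    refine ⟨ι f0 + C (v (Fin.last n)) * (X (Fin.last n) - ι (monomial w 1)),
      Ideal.add_mem _ (hιI _ hf0) (Ideal.mul_mem_left _ _ hB), ?_⟩
    ext i
    rw [LinearMap.pi_apply]
    refine Fin.lastCases ?_ (fun i => ?_) i
    · simp only [Fin.lastCases_last, map_add, hΛι, ← smul_eq_C_mul, map_smul, map_sub]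
      rw [hΛ, coeff_X]
      simp
    · simp only [Fin.lastCases_castSucc, LinearMap.comp_apply, AlgHom.toLinearMap_apply, map_mul, map_add, map_sub, π1, πι, sub_self, mul_zero, hf1, LinearMap.proj_apply]
      simp

/-- normal form criterion for generators of the toric ideal -/
lemma eq_toric_of_nf (d : Fin n → ℕ) (J : Ideal (MvPolynomial (Fin n) k))
    (hJ : J ≤ toricIdeal k d) (N : Set (Fin n →₀ ℕ))
    (hN : ∀ u ∈ N, ∀ v ∈ N, wt d u = wt d v → u = v)
    (hred : ∀ u, ∃ v ∈ N, (monomial u (1 : k) - monomial v 1) ∈ J) : J = toricIdeal k d := by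
  classical
  refine le_antisymm hJ fun f hf => ?_
  choose nf hnf hnfJ using hred
  have hwt : ∀ u, wt d (nf u) = wt d u := by
    intro u
    have := hJ (hnfJ u)
    rw [mem_toric_iff, map_sub, aeval_mono, aeval_mono, sub_eq_zero] at this
    by_contra hne
    have h2 := congrArg (fun P => Polynomial.coeff P (wt d u)) this
    simp [Polynomial.coeff_monomial, hne] at h2
  have hfix : ∀ u v, wt d u = wt d v → nf u = nf v := fun u v h =>
    hN _ (hnf u) _ (hnf v) (by rw [hwt, hwt, h])
  have h1 : f - ∑ u ∈ f.support, monomial (nf u) (coeff u f) ∈ J := by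
    have e : f - ∑ u ∈ f.support, monomial (nf u) (coeff u f)
        = ∑ u ∈ f.support, (monomial u (coeff u f) - monomial (nf u) (coeff u f)) := by
      rw [Finset.sum_sub_distrib]
      congr 1
      exact f.as_sum
    rw [e]
    refine Ideal.sum_mem _ fun u _ => ?_
    have := Ideal.mul_mem_left J (C (coeff u f)) (hnfJ u)
    rwa [mul_sub, C_mul_monomial, C_mul_monomial, mul_one] at this
  have h2 : ∑ u ∈ f.support, monomial (nf u) (coeff u f) = 0 := by
    rw [mem_toric_iff, aeval_eq_sum] at hf
    ext m
    rw [coeff_sum, coeff_zero]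
    simp only [coeff_monomial]
    by_cases hm : ∃ u0, nf u0 = m
    · obtain ⟨u0, rfl⟩ := hm
      have := congrArg (fun P => Polynomial.coeff P (wt d u0)) hf
      simp only [Polynomial.finsetSum_coeff, Polynomial.coeff_monomial,
        Polynomial.coeff_zero] at this
      refine Eq.trans ?_ this
      refine Finset.sum_congr rfl fun u _ => ?_
      have : nf u = nf u0 ↔ wt d u = wt d u0 :=
        ⟨fun h => by rw [← hwt u, h, hwt], hfix u u0⟩
      simp only [this]
    · refine Finset.sum_eq_zero fun u _ => if_neg fun h => hm ⟨u, h⟩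
  rw [h2, sub_zero] at h1
  exact h1

/-- all monomials reduce to `x0^a x1^b` when every variable does. -/
lemma red_two (J : Ideal (MvPolynomial (Fin n) k)) (i0 i1 : Fin n)
    (h : ∀ i, ∃ a b : ℕ, (X i - X i0 ^ a * X i1 ^ b : MvPolynomial (Fin n) k) ∈ J)
    (u : Fin n →₀ ℕ) :
    ∃ a b : ℕ, (monomial u 1 - X i0 ^ a * X i1 ^ b : MvPolynomial (Fin n) k) ∈ J := by
  simp only [← Ideal.Quotient.mk_eq_mk_iff_sub_mem] at h ⊢
  induction u using Finsupp.induction_linear with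
  | zero => exact ⟨0, 0, by simp⟩
  | add f g hf hg =>
    obtain ⟨a, b, h1⟩ := hf
    obtain ⟨a', b', h2⟩ := hg
    refine ⟨a + a', b + b', ?_⟩
    have : (monomial (f + g) 1 : MvPolynomial (Fin n) k) = monomial f 1 * monomial g 1 := by
      rw [monomial_mul, one_mul]
    rw [this, map_mul, h1, h2]
    simp only [map_mul, map_pow]
    ring
  | single i c =>
    obtain ⟨a, b, h1⟩ := h i
    refine ⟨a * c, b * c, ?_⟩
    rw [← X_pow_eq_monomial, map_pow, h1]
    simp only [map_mul, map_pow]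
    ring

lemma CI_two (d : Fin n → ℕ) (hn : 2 ≤ n) (hpos : ∀ i, 0 < d i)
    (h : ∀ i : Fin n, ∃ a b : ℕ, d i = a * d ⟨0, by omega⟩ + b * d ⟨1, by omega⟩) : IsCI k d := by
  classical
  set i0 : Fin n := ⟨0, by omega⟩ with hi0
  set i1 : Fin n := ⟨1, by omega⟩ with hi1
  have h01 : i0 ≠ i1 := by simp [hi0, hi1]
  choose α β hαβ using h
  set G := Nat.gcd (d i0) (d i1) with hG
  have hGpos : 0 < G := Nat.gcd_pos_of_pos_left _ (hpos _)
  obtain ⟨D0, hD0⟩ := Nat.gcd_dvd_left (d i0) (d i1)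
  obtain ⟨D1, hD1⟩ := Nat.gcd_dvd_right (d i0) (d i1)
  rw [← hG] at hD0 hD1
  have hcop : Nat.Coprime D0 D1 := by
    have := Nat.coprime_div_gcd_div_gcd (m := d i0) (n := d i1) hGpos
    rw [← hG] at this
    rw [hD0, hD1, Nat.mul_div_cancel_left _ hGpos, Nat.mul_div_cancel_left _ hGpos] at this
    exact this
  have hD0pos : 0 < D0 := by
    have := hpos i0; rw [hD0] at this; exact Nat.pos_of_mul_pos_left this
  let g : Fin (n - 1) → MvPolynomial (Fin n) k := fun l =>
    if hl : (l : ℕ) = 0 then X i0 ^ D1 - X i1 ^ D0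
    else X ⟨l + 1, by omega⟩ - X i0 ^ α ⟨l + 1, by omega⟩ * X i1 ^ β ⟨l + 1, by omega⟩
  refine ⟨g, ?_⟩
  have hg0 : (X i0 ^ D1 - X i1 ^ D0 : MvPolynomial (Fin n) k) ∈ Ideal.span (Set.range g) := by
    refine Ideal.subset_span ⟨⟨0, by omega⟩, ?_⟩
    simp [g]
  have hgi : ∀ i : Fin n, ∃ a b : ℕ,
      (X i - X i0 ^ a * X i1 ^ b : MvPolynomial (Fin n) k) ∈ Ideal.span (Set.range g) := by
    intro i
    rcases Nat.lt_or_ge (i : ℕ) 2 with hi | hi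
    · have : i = i0 ∨ i = i1 := by
        simp only [hi0, hi1, Fin.ext_iff]; omega
      rcases this with rfl | rfl
      · exact ⟨1, 0, by simp⟩
      · exact ⟨0, 1, by simp⟩
    · refine ⟨α i, β i, Ideal.subset_span ⟨⟨i - 1, by omega⟩, ?_⟩⟩
      have e : (⟨(i : ℕ) - 1 + 1, by omega⟩ : Fin n) = i := by
        ext; simp; omega
      simp only [g]
      rw [dif_neg (by omega), e]
  refine eq_toric_of_nf d _ ?_ {u | ∃ a b : ℕ, b < D0 ∧ u = Finsupp.single i0 a + Finsupp.single i1 b} ?_ ?_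
  · rw [Ideal.span_le]
    rintro _ ⟨l, rfl⟩
    rw [SetLike.mem_coe, mem_toric_iff]
    simp only [g]
    split_ifs with hl
    · simp only [map_sub, map_pow, aeval_X, ← pow_mul]
      rw [hD0, hD1, sub_eq_zero]
      congr 1; ring
    · simp only [map_sub, map_mul, map_pow, aeval_X, ← pow_mul, ← pow_add]
      rw [hαβ ⟨l + 1, by omega⟩, sub_eq_zero]
      congr 1; ring
  · rintro _ ⟨a, b, hb, rfl⟩ _ ⟨a', b', hb', rfl⟩ hw
    simp only [wt_add, wt_single] at hw
    have e : a * D0 + b * D1 = a' * D0 + b' * D1 := by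
      apply Nat.eq_of_mul_eq_mul_left hGpos
      rw [hD0, hD1] at hw
      nlinarith
    have hmod : b * D1 ≡ b' * D1 [MOD D0] := by
      have : (a * D0 + b * D1) % D0 = (a' * D0 + b' * D1) % D0 := by rw [e]
      simpa [Nat.ModEq, Nat.add_mod] using this
    have : b ≡ b' [MOD D0] := Nat.ModEq.cancel_right_of_coprime hcop hmod
    have hbb : b = b' := by
      unfold Nat.ModEq at this
      rwa [Nat.mod_eq_of_lt hb, Nat.mod_eq_of_lt hb'] at this
    subst hbb
    have : a = a' := Nat.eq_of_mul_eq_mul_right hD0pos (by omega)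
    rw [this]
  · intro u
    obtain ⟨a, b, h1⟩ := red_two _ i0 i1 hgi u
    refine ⟨_, ⟨a + D1 * (b / D0), b % D0, Nat.mod_lt _ hD0pos, rfl⟩, ?_⟩
    rw [← Ideal.Quotient.mk_eq_mk_iff_sub_mem] at h1 hg0 ⊢
    rw [h1]
    have e : (monomial (Finsupp.single i0 (a + D1 * (b / D0)) + Finsupp.single i1 (b % D0)) 1
        : MvPolynomial (Fin n) k) = X i0 ^ (a + D1 * (b / D0)) * X i1 ^ (b % D0) := by
      rw [X_pow_eq_monomial, X_pow_eq_monomial, monomial_mul, one_mul]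
    rw [e]
    simp only [map_mul, map_pow, pow_add, pow_mul] at hg0 ⊢
    rw [hg0]
    conv_lhs => rw [← Nat.div_add_mod b D0]
    rw [pow_add, pow_mul]
    ring

end alg

/-- gluing: three generators `L u, e, L v`. -/
lemma CI_three (k : Type*) [Field k] (d : Fin 3 → ℕ) (L Q u v : ℕ) (hL : 0 < L) (hu : 0 < u)
    (h0 : d 0 = L * u) (h2 : d 2 = L * v) (hr : L * d 1 = Q * d 0 + d 2)
    (huv : Nat.Coprime u v) (hL1 : Nat.Coprime L (d 1)) : IsCI k d := by
  classical
  let g : Fin (3 - 1) → MvPolynomial (Fin 3) k :=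
    ![X 1 ^ L - X 0 ^ Q * X 2, X 0 ^ v - X 2 ^ u]
  refine ⟨g, ?_⟩
  have hg0 : (X 1 ^ L - X 0 ^ Q * X 2 : MvPolynomial (Fin 3) k) ∈ Ideal.span (Set.range g) :=
    Ideal.subset_span ⟨0, rfl⟩
  have hg1 : (X 0 ^ v - X 2 ^ u : MvPolynomial (Fin 3) k) ∈ Ideal.span (Set.range g) :=
    Ideal.subset_span ⟨1, rfl⟩
  refine eq_toric_of_nf d _ ?_ {m | m 1 < L ∧ m 2 < u} ?_ ?_
  · rw [Ideal.span_le]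
    rintro _ ⟨l, rfl⟩
    rw [SetLike.mem_coe, mem_toric_iff]
    fin_cases l
    · simp only [g, Fin.zero_eta, Matrix.cons_val_zero, map_sub, map_mul, map_pow, aeval_X, ← pow_mul, ← pow_add]
      rw [sub_eq_zero]; congr 1; rw [mul_comm, hr]; ring
    · simp only [g, Fin.mk_one, Matrix.cons_val_one, Matrix.cons_val_zero, map_sub, map_mul, map_pow, aeval_X, ← pow_mul, ← pow_add]
      rw [sub_eq_zero]; congr 1; rw [h0, h2]; ring
  · rintro m ⟨hm1, hm2⟩ m' ⟨hm1', hm2'⟩ hw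
    simp only [wt, Fin.sum_univ_three] at hw
    have e1 : m 1 = m' 1 := by
      have hmod : m 1 * d 1 ≡ m' 1 * d 1 [MOD L] := by
        have : (m 0 * d 0 + m 1 * d 1 + m 2 * d 2) % L = (m' 0 * d 0 + m' 1 * d 1 + m' 2 * d 2) % L := by
          rw [hw]
        rw [h0, h2] at this
        have e : ∀ x y z : ℕ, (x * (L * u) + y + z * (L * v)) % L = y % L := by
          intro x y z
          have : x * (L * u) + y + z * (L * v) = y + L * (x * u + z * v) := by ring
          rw [this, Nat.add_mul_mod_self_left]
        rw [e, e] at this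
        exact this
      have := Nat.ModEq.cancel_right_of_coprime hL1 hmod
      unfold Nat.ModEq at this
      rwa [Nat.mod_eq_of_lt hm1, Nat.mod_eq_of_lt hm1'] at this
    have e3 : m 0 * u + m 2 * v = m' 0 * u + m' 2 * v := by
      apply Nat.eq_of_mul_eq_mul_left hL
      rw [h0, h2, e1] at hw
      nlinarith
    have e2 : m 2 = m' 2 := by
      have hmod : m 2 * v ≡ m' 2 * v [MOD u] := by
        have : (m 0 * u + m 2 * v) % u = (m' 0 * u + m' 2 * v) % u := by rw [e3]
        simpa [Nat.ModEq, Nat.add_mod] using this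
      have := Nat.ModEq.cancel_right_of_coprime huv hmod
      unfold Nat.ModEq at this
      rwa [Nat.mod_eq_of_lt hm2, Nat.mod_eq_of_lt hm2'] at this
    have e0 : m 0 = m' 0 := by
      rw [e2] at e3
      exact Nat.eq_of_mul_eq_mul_right hu (by omega)
    ext i
    fin_cases i
    · exact e0
    · exact e1
    · exact e2
  · intro m
    let c := m 2 + m 1 / L
    refine ⟨Finsupp.single 0 (m 0 + Q * (m 1 / L) + v * (c / u)) + Finsupp.single 1 (m 1 % L)
      + Finsupp.single 2 (c % u), ⟨?_, ?_⟩, ?_⟩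
    · simpa using Nat.mod_lt _ hL
    · simpa using Nat.mod_lt _ hu
    rw [← Ideal.Quotient.mk_eq_mk_iff_sub_mem] at hg0 hg1 ⊢
    have e : ∀ a b c : ℕ, (monomial (Finsupp.single 0 a + Finsupp.single 1 b + Finsupp.single 2 c) 1
        : MvPolynomial (Fin 3) k) = X 0 ^ a * X 1 ^ b * X 2 ^ c := by
      intro a b c
      rw [X_pow_eq_monomial, X_pow_eq_monomial, X_pow_eq_monomial, monomial_mul, monomial_mul]
      simp
    have em : m = Finsupp.single 0 (m 0) + Finsupp.single 1 (m 1) + Finsupp.single 2 (m 2) := by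
      ext i; fin_cases i <;> simp
    conv_lhs => rw [em]
    rw [e, e]
    simp only [map_mul, map_pow, pow_add, pow_mul] at hg0 hg1 ⊢
    rw [hg1]
    conv_lhs => rw [← Nat.div_add_mod (m 1) L]
    rw [pow_add, pow_mul, hg0]
    set x := (Ideal.Quotient.mk (Ideal.span (Set.range g))) (X 0)
    set y := (Ideal.Quotient.mk (Ideal.span (Set.range g))) (X 1)
    set z := (Ideal.Quotient.mk (Ideal.span (Set.range g))) (X 2)
    have ec : z ^ (m 2) * z ^ (m 1 / L) = (z ^ u) ^ (c / u) * z ^ (c % u) := by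
      rw [← pow_add, ← pow_mul, ← pow_add, Nat.div_add_mod]
    rw [mul_pow]
    linear_combination x ^ m 0 * (x ^ Q) ^ (m 1 / L) * y ^ (m 1 % L) * ec

section lucas
variable {p q : ℕ}

lemma L_rec (n : ℕ) : pqLucas p q (n + 2) = p * pqLucas p q (n + 1) + q * pqLucas p q n := rfl
lemma F_rec (n : ℕ) : pqFib p q (n + 2) = p * pqFib p q (n + 1) + q * pqFib p q n := rfl

lemma L_pos (hp : 0 < p) (n : ℕ) : 0 < pqLucas p q n := by
  induction n using Nat.twoStepInduction with
  | zero => simp [pqLucas]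
  | one => simpa [pqLucas] using hp
  | more n h1 h2 => rw [L_rec]; positivity

lemma F_pos (hp : 0 < p) (n : ℕ) : 0 < pqFib p q (n + 1) := by
  induction n using Nat.twoStepInduction with
  | zero => simp [pqFib]
  | one => simpa [pqFib] using hp
  | more n h1 h2 => rw [F_rec]; positivity

lemma F_mono (hp : 0 < p) (n : ℕ) : pqFib p q n ≤ pqFib p q (n + 1) := by
  cases n with
  | zero => simp [pqFib]
  | succ n => rw [F_rec]; nlinarith [Nat.zero_le (q * pqFib p q n), Nat.zero_le (pqFib p q (n+1))]

lemma L_lt_succ (hp : 0 < p) (hq : 0 < q) {n : ℕ} (hn : 1 ≤ n) :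
    pqLucas p q n < pqLucas p q (n + 1) := by
  obtain ⟨m, rfl⟩ : ∃ m, n = m + 1 := ⟨n - 1, by omega⟩
  rw [L_rec]
  have h1 := L_pos (q := q) hp (m + 1)
  have h2 := L_pos (q := q) hp m
  nlinarith [Nat.mul_pos hq h2]

lemma L_mono (hp : 0 < p) (hq : 0 < q) {m n : ℕ} (hm : 1 ≤ m) (hmn : m ≤ n) :
    pqLucas p q m ≤ pqLucas p q n := by
  induction n, hmn using Nat.le_induction with
  | base => exact le_rfl
  | succ n h ih => exact ih.trans (L_lt_succ hp hq (by omega)).le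

lemma L_strict (hp : 0 < p) (hq : 0 < q) {m n : ℕ} (hm : 1 ≤ m) (hmn : m < n) :
    pqLucas p q m < pqLucas p q n :=
  (L_lt_succ hp hq hm).trans_le (L_mono hp hq (by omega) hmn)

lemma L_two (hp : 0 < p) (hq : 0 < q) {n : ℕ} (hn : 1 ≤ n) :
    2 * pqLucas p q n < pqLucas p q (n + 2) := by
  rw [L_rec]
  have h1 := L_lt_succ hp hq hn
  nlinarith [L_pos (q := q) hp n]

lemma L_two' (hp : 0 < p) (hq : 0 < q) {m n : ℕ} (hm : 1 ≤ m) (h : m + 2 ≤ n) :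
    2 * pqLucas p q m < pqLucas p q n :=
  (L_two hp hq hm).trans_le (L_mono hp hq (by omega) h)

lemma L_q (hp : 0 < p) (m e : ℕ) (he : 1 ≤ e) :
    q ^ e * pqLucas p q m < pqLucas p q (m + 2 * e) := by
  have h1 : ∀ n, q * pqLucas p q n < pqLucas p q (n + 2) := by
    intro n; rw [L_rec]
    have := Nat.mul_pos hp (L_pos (q := q) hp (n+1))
    omega
  induction e, he using Nat.le_induction with
  | base => simpa using h1 m
  | succ e he ih =>
    have h2 := h1 (m + 2 * e)
    have : m + 2 * (e + 1) = m + 2 * e + 2 := by ring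
    rw [this, pow_succ]
    refine lt_of_le_of_lt ?_ h2
    calc q ^ e * q * pqLucas p q m = q * (q ^ e * pqLucas p q m) := by ring
      _ ≤ _ := Nat.mul_le_mul_left _ ih.le

lemma roots (p q : ℕ) (hp : 0 < p) : ∃ α β : ℝ, α + β = p ∧ α * β = -q ∧ α ≠ β ∧
    (∀ n, (pqLucas p q n : ℝ) = α ^ n + β ^ n) ∧
    (∀ n, (α - β) * (pqFib p q n : ℝ) = α ^ n - β ^ n) := by
  have hs : Real.sqrt ((p:ℝ) ^ 2 + 4 * q) ^ 2 = (p:ℝ) ^ 2 + 4 * q := Real.sq_sqrt (by positivity)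
  have hpos : 0 < Real.sqrt ((p:ℝ) ^ 2 + 4 * q) := by
    apply Real.sqrt_pos.mpr
    have : (0:ℝ) < p := by exact_mod_cast hp
    positivity
  set s := Real.sqrt ((p:ℝ) ^ 2 + 4 * q)
  have hsum : (p + s) / 2 + (p - s) / 2 = p := by ring
  have hprod : (p + s) / 2 * ((p - s) / 2) = -q := by nlinarith
  refine ⟨(p + s) / 2, (p - s) / 2, hsum, hprod, by intro h; linarith, ?_, ?_⟩
  · intro n
    induction n using Nat.twoStepInduction with
    | zero => simp [pqLucas]; norm_num
    | one => simp only [pqLucas, pow_one]; linarith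
    | more n h1 h2 =>
      rw [L_rec]; push_cast; rw [h1, h2]
      generalize (p + s) / 2 = α at *
      generalize (p - s) / 2 = β at *
      rw [← hsum]
      have : (q : ℝ) = -(α * β) := by linarith
      rw [this]; ring
  · intro n
    induction n using Nat.twoStepInduction with
    | zero => simp [pqFib]
    | one => simp [pqFib]
    | more n h1 h2 =>
      rw [F_rec]; push_cast
      generalize (p + s) / 2 = α at *
      generalize (p - s) / 2 = β at *
      rw [mul_add, mul_left_comm, mul_left_comm _ (q:ℝ), h1, h2]
      rw [← hsum]
      have : (q : ℝ) = -(α * β) := by linarith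
      rw [this]; ring

lemma L_id (hp : 0 < p) (m e : ℕ) :
    (pqLucas p q (m + 2 * e) : ℤ) + (-(q:ℤ)) ^ e * pqLucas p q m
      = pqLucas p q e * pqLucas p q (m + e) := by
  obtain ⟨α, β, hs, hm, -, hL, -⟩ := roots p q hp
  have : ((pqLucas p q (m + 2 * e) : ℝ)) + (-(q:ℝ)) ^ e * pqLucas p q m
      = pqLucas p q e * pqLucas p q (m + e) := by
    simp only [hL]
    rw [← hm]; ring
  exact_mod_cast this

lemma F_id (hp : 0 < p) (m e : ℕ) :
    (pqFib p q (m + 2 * e) : ℤ) + (-(q:ℤ)) ^ e * pqFib p q m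
      = pqLucas p q e * pqFib p q (m + e) := by
  obtain ⟨α, β, hs, hm, hne, hL, hF⟩ := roots p q hp
  have : ((pqFib p q (m + 2 * e) : ℝ)) + (-(q:ℝ)) ^ e * pqFib p q m
      = pqLucas p q e * pqFib p q (m + e) := by
    apply mul_left_cancel₀ (sub_ne_zero.mpr hne)
    rw [mul_add, mul_left_comm, mul_left_comm _ (pqLucas p q e : ℝ), hF, hF, hF]
    simp only [hL]
    rw [← hm]; ring
  exact_mod_cast this

lemma L_even (hp : 0 < p) (m e : ℕ) (he : Even e) :
    pqLucas p q (m + 2 * e) + q ^ e * pqLucas p q m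
      = pqLucas p q e * pqLucas p q (m + e) := by
  have := L_id (q := q) hp m e
  rw [he.neg_pow] at this
  exact_mod_cast this

lemma L_odd (hp : 0 < p) (m e : ℕ) (he : Odd e) :
    pqLucas p q (m + 2 * e) = q ^ e * pqLucas p q m
      + pqLucas p q e * pqLucas p q (m + e) := by
  have := L_id (q := q) hp m e
  rw [he.neg_pow] at this
  zify; linarith

lemma L_le_prod (hp : 0 < p) (m n : ℕ) :
    pqLucas p q m * pqLucas p q n < 2 * pqLucas p q (m + n) ∨ m = 0 ∨ n = 0 := by
  rcases Nat.eq_zero_or_pos m with hm | hm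
  · simp [hm]
  rcases Nat.eq_zero_or_pos n with hn | hn
  · simp [hn]
  left
  wlog h : m ≤ n generalizing m n
  · rw [mul_comm, add_comm]; exact this n m hn hm (by omega)
  obtain ⟨e, rfl⟩ := Nat.exists_eq_add_of_le h
  have h1 := L_q (q := q) hp e m hm
  rcases Nat.even_or_odd m with hm' | hm'
  · have h2 := L_even (q := q) hp e m hm'
    rw [show m + (m + e) = e + 2 * m by ring, show m + e = e + m by ring]
    omega
  · have h2 := L_odd (q := q) hp e m hm'
    rw [show m + (m + e) = e + 2 * m by ring, show m + e = e + m by ring]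
    have := L_pos (q := q) hp (e + 2 * m)
    omega

lemma L_coprime (hpq : Nat.gcd p q = 1) (n : ℕ) (hn : 1 ≤ n) :
    Nat.Coprime (pqLucas p q n) q := by
  obtain ⟨m, rfl⟩ : ∃ m, n = m + 1 := ⟨n - 1, by omega⟩
  clear hn
  induction m with
  | zero => exact hpq
  | succ m ih =>
    rw [L_rec, Nat.coprime_add_mul_left_left]
    exact Nat.Coprime.mul_left hpq ih

lemma L_add (m n : ℕ) : pqLucas p q (m + 1 + n)
    = pqFib p q (n + 1) * pqLucas p q (m + 1) + q * pqFib p q n * pqLucas p q m := by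
  induction n using Nat.twoStepInduction with
  | zero => simp [pqFib]
  | one => simp only [pqFib]; rw [L_rec]; ring
  | more n h1 h2 =>
    rw [show m + 1 + (n + 2) = (m + 1 + n) + 2 by ring, L_rec,
      show m + 1 + n + 1 = m + 1 + (n + 1) by ring, h2, h1, F_rec (n + 1), F_rec n]
    ring

lemma L_ge_F (hp : 0 < p) (m n : ℕ) (hm : 1 ≤ m) :
    pqFib p q n * pqLucas p q m ≤ pqLucas p q (m + n) := by
  obtain ⟨m, rfl⟩ : ∃ m', m = m' + 1 := ⟨m - 1, by omega⟩
  rw [L_add]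
  have := Nat.mul_le_mul_right (pqLucas p q (m + 1)) (F_mono (q := q) hp n)
  omega

/-- divisibility of both odd multiples -/
lemma L_dvd (hp : 0 < p) (g m : ℕ) (hm : Odd m) : pqLucas p q g ∣ pqLucas p q (g * m) := by
  obtain ⟨t, rfl⟩ := hm
  induction t with
  | zero => simp
  | succ t ih =>
    have h := L_id (q := q) hp (g * (2 * t + 1)) g
    rw [show g * (2 * (t + 1) + 1) = g * (2 * t + 1) + 2 * g by ring]
    zify at ih ⊢
    have : (pqLucas p q (g * (2 * t + 1) + 2 * g) : ℤ) =
      pqLucas p q g * pqLucas p q (g * (2 * t + 1) + g) -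
        (-(q:ℤ)) ^ g * pqLucas p q (g * (2 * t + 1)) := by linarith
    rw [this]
    exact dvd_sub (dvd_mul_right _ _) (Dvd.dvd.mul_left ih _)

/-- reflection -/
lemma refl_dvd (hp : 0 < p) (hpq : Nat.gcd p q = 1) (D m e : ℕ) (hne : 1 ≤ m + e)
    (h1 : D ∣ pqLucas p q (m + 2 * e)) (h2 : D ∣ pqLucas p q (m + e)) : D ∣ pqLucas p q m := by
  have h := L_id (q := q) hp m e
  have hc : Nat.Coprime D (q ^ e) :=
    Nat.Coprime.pow_right _ (Nat.Coprime.of_dvd_left h2 (L_coprime hpq _ hne))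
  have : D ∣ q ^ e * pqLucas p q m := by
    zify at h1 h2 ⊢
    have h3 : (D : ℤ) ∣ (-(q:ℤ)) ^ e * pqLucas p q m := by
      have : (-(q:ℤ)) ^ e * pqLucas p q m = pqLucas p q e * pqLucas p q (m + e) -
        pqLucas p q (m + 2 * e) := by linarith
      rw [this]
      exact dvd_sub (Dvd.dvd.mul_left h2 _) h1
    rw [neg_pow] at h3
    rcases Nat.even_or_odd e with he | he
    · simpa [he.neg_one_pow] using h3
    · simpa [he.neg_one_pow] using h3
  exact hc.dvd_of_dvd_mul_left this

lemma refl_dvd' (hp : 0 < p) (hpq : Nat.gcd p q = 1) (D m e : ℕ) (he : 1 ≤ e)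
    (h1 : D ∣ pqLucas p q (m + 2 * e)) (h2 : D ∣ pqLucas p q e) : D ∣ pqLucas p q m := by
  have h := L_id (q := q) hp m e
  have hc : Nat.Coprime D (q ^ e) :=
    Nat.Coprime.pow_right _ (Nat.Coprime.of_dvd_left h2 (L_coprime hpq _ he))
  have : D ∣ q ^ e * pqLucas p q m := by
    zify at h1 h2 ⊢
    have h3 : (D : ℤ) ∣ (-(q:ℤ)) ^ e * pqLucas p q m := by
      have : (-(q:ℤ)) ^ e * pqLucas p q m = pqLucas p q e * pqLucas p q (m + e) -
        pqLucas p q (m + 2 * e) := by linarith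
      rw [this]
      exact dvd_sub (Dvd.dvd.mul_right h2 _) h1
    rw [neg_pow] at h3
    rcases Nat.even_or_odd e with he | he
    · simpa [he.neg_one_pow] using h3
    · simpa [he.neg_one_pow] using h3
  exact hc.dvd_of_dvd_mul_left this

lemma gcdL_aux (hp : 0 < p) (hpq : Nat.gcd p q = 1) (D g : ℕ) (hg : 1 ≤ g) :
    ∀ s m n : ℕ, m + n = s → Nat.Coprime m n → D ∣ pqLucas p q (g * m) →
      D ∣ pqLucas p q (g * n) →
      ((Odd m ∧ Odd n) → D ∣ pqLucas p q g) ∧ (¬ (Odd m ∧ Odd n) → D ∣ 2) := by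
  intro s
  induction s using Nat.strong_induction_on with
  | _ s ih =>
    intro m n hs hc h1 h2
    wlog hmn : n ≤ m generalizing m n
    · have := this n m (by omega) hc.symm h2 h1 (by omega)
      rwa [and_comm (a := Odd m)]
    rcases Nat.eq_zero_or_pos n with rfl | hn
    · constructor
      · rintro ⟨_, h⟩; simp at h
      · intro _; simpa [pqLucas] using h2
    rcases Nat.eq_or_lt_of_le hmn with rfl | hlt
    · have : n = 1 := by simpa using hc
      subst this
      constructor
      · intro _; simpa using h1
      · intro h; exact absurd ⟨odd_one, odd_one⟩ h
    rcases Nat.lt_or_ge m (2 * n) with h3 | h3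
    · obtain ⟨e, rfl⟩ := Nat.exists_eq_add_of_lt hlt
      obtain ⟨r, hr⟩ : ∃ r, n = r + (e + 1) := ⟨n - (e + 1), by omega⟩
      have hd : D ∣ pqLucas p q (g * r) := by
        apply refl_dvd hp hpq D (g * r) (g * (e + 1)) (by nlinarith)
        · rwa [show g * r + 2 * (g * (e + 1)) = g * (n + e + 1) by rw [hr]; ring]
        · rwa [show g * r + g * (e + 1) = g * n by rw [hr]; ring]
      have hc' : Nat.Coprime r n := by
        have e1 : n + e + 1 = 2 * n - r := by omega
        have : Nat.Coprime (r + (n + e + 1)) n → True := fun _ => trivial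
        have h5 : r + (n + e + 1) = n * 2 := by omega
        have h6 := Nat.gcd_dvd_left r n
        have h7 := Nat.gcd_dvd_right r n
        have h8 : Nat.gcd r n ∣ n + e + 1 := by
          rw [← Nat.dvd_add_right h6, h5]; exact Dvd.dvd.mul_right h7 _
        exact Nat.dvd_one.mp (hc ▸ Nat.dvd_gcd h8 h7)
      have := ih (r + n) (by omega) r n rfl hc' hd h2
      have hpar : Odd r ↔ Odd (n + e + 1) := by
        have h5 : r + (n + e + 1) = n * 2 := by omega
        rw [Nat.odd_iff, Nat.odd_iff]; omega
      rwa [hpar] at this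
    · obtain ⟨r, rfl⟩ := Nat.exists_eq_add_of_le' h3
      have hd : D ∣ pqLucas p q (g * r) := by
        apply refl_dvd' hp hpq D (g * r) (g * n) (by nlinarith) _ h2
        rwa [show g * r + 2 * (g * n) = g * (r + 2 * n) by ring]
      have hc' : Nat.Coprime r n := by
        have := (Nat.coprime_add_mul_right_left r n 2).mp hc
        exact this
      have := ih (r + n) (by omega) r n rfl hc' hd h2
      have hpar : Odd r ↔ Odd (r + 2 * n) := by
        rw [Nat.odd_iff, Nat.odd_iff]; omega
      rwa [hpar] at this

lemma gcdL (hp : 0 < p) (hpq : Nat.gcd p q = 1) (D m n : ℕ) (hm : 1 ≤ m)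
    (h1 : D ∣ pqLucas p q m) (h2 : D ∣ pqLucas p q n) :
    ∃ g m' n', g = Nat.gcd m n ∧ 1 ≤ g ∧ m = g * m' ∧ n = g * n' ∧ Nat.Coprime m' n' ∧
      ((Odd m' ∧ Odd n' ∧ D ∣ pqLucas p q g) ∨ (¬ (Odd m' ∧ Odd n') ∧ D ∣ 2)) := by
  have hg : 0 < Nat.gcd m n := Nat.gcd_pos_of_pos_left _ hm
  obtain ⟨m', n', hc, e1, e2⟩ := Nat.exists_coprime m n
  rw [mul_comm] at e1 e2
  refine ⟨Nat.gcd m n, m', n', rfl, hg, e1, e2, hc, ?_⟩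
  rw [e1] at h1
  rw [e2] at h2
  have := gcdL_aux hp hpq D _ hg _ m' n' rfl hc h1 h2
  tauto

lemma L_parity1 (hp : Odd p) (hq : Even q) (n : ℕ) (hn : 1 ≤ n) : Odd (pqLucas p q n) := by
  obtain ⟨m, rfl⟩ : ∃ m, n = m + 1 := ⟨n - 1, by omega⟩
  clear hn
  induction m with
  | zero => exact hp
  | succ m ih => rw [L_rec]; exact (hp.mul ih).add_even (hq.mul_right _)

lemma L_parity2 (hp : Odd p) (hq : Odd q) (n : ℕ) : Even (pqLucas p q n) ↔ 3 ∣ n := by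
  have : ∀ t, Even (pqLucas p q (3 * t)) ∧ Odd (pqLucas p q (3 * t + 1)) ∧ Odd (pqLucas p q (3 * t + 2)) := by
    intro t
    induction t with
    | zero =>
      refine ⟨by simp [pqLucas], by simpa [pqLucas] using hp, ?_⟩
      simp only [pqLucas]
      exact (hp.mul hp).add_even (by simp)
    | succ t ih =>
      obtain ⟨h0, h1, h2⟩ := ih
      have h3 : Even (pqLucas p q (3 * t + 1 + 2)) := by
        rw [L_rec]; exact (hp.mul h2).add_odd (hq.mul h1)
      have h4 : Odd (pqLucas p q (3 * t + 2 + 2)) := by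
        rw [L_rec]; exact Even.add_odd (h3.mul_left _) (hq.mul h2)
      have h5 : Odd (pqLucas p q (3 * t + 3 + 2)) := by
        rw [L_rec]; exact Odd.add_even (hp.mul h4) (Even.mul_left h3 _)
      exact ⟨h3, h4, h5⟩
  have h := this (n / 3)
  rcases (by omega : n = 3 * (n / 3) ∨ n = 3 * (n / 3) + 1 ∨ n = 3 * (n / 3) + 2) with e | e | e
  · rw [← e] at h; constructor
    · intro _; omega
    · intro _; exact h.1
  · rw [← e] at h; constructor
    · intro h'; exact absurd h' (Nat.not_even_iff_odd.mpr h.2.1)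
    · intro _; omega
  · rw [← e] at h; constructor
    · intro h'; exact absurd h' (Nat.not_even_iff_odd.mpr h.2.2)
    · intro _; omega

lemma L_parity3 (hp : Even p) (n : ℕ) : Even (pqLucas p q n) := by
  induction n using Nat.twoStepInduction with
  | zero => simp [pqLucas]
  | one => simpa [pqLucas] using hp
  | more n h1 h2 => rw [L_rec]; exact (h2.mul_left _).add (h1.mul_left _)

end lucas

/-- Frobenius -/
lemma frob (x y N : ℕ) (hx : 0 < x) (hd : Nat.gcd x y ∣ N)
    (h : x * y ≤ N * Nat.gcd x y) : ∃ u v : ℕ, N = u * x + v * y := by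
  set G := Nat.gcd x y with hG
  have hGpos : 0 < G := Nat.gcd_pos_of_pos_left _ hx
  obtain ⟨x', hx'⟩ := Nat.gcd_dvd_left x y
  obtain ⟨y', hy'⟩ := Nat.gcd_dvd_right x y
  rw [← hG] at hx' hy'
  obtain ⟨N', hN'⟩ := hd
  have hcop : Nat.Coprime y' x' := by
    have := Nat.coprime_div_gcd_div_gcd (m := x) (n := y) hGpos
    rw [← hG] at this
    rw [hx', hy', Nat.mul_div_cancel_left _ hGpos, Nat.mul_div_cancel_left _ hGpos] at this
    exact this.symm
  have hx'pos : 0 < x' := by rw [hx'] at hx; exact Nat.pos_of_mul_pos_left hx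
  have hle : x' * y' ≤ N' := by
    rw [hx', hy', hN'] at h
    have : (G * G) * (x' * y') ≤ (G * G) * N' := by nlinarith
    exact Nat.le_of_mul_le_mul_left this (by positivity)
  obtain ⟨v, hv1, hv2⟩ : ∃ v, v < x' ∧ v * y' ≡ N' [MOD x'] := by
    obtain ⟨z, hz⟩ := Nat.exists_mul_mod_eq_of_coprime N' hcop (by omega)
    refine ⟨z % x', Nat.mod_lt _ hx'pos, ?_⟩
    have : z % x' * y' ≡ z * y' [MOD x'] := Nat.ModEq.mul_right _ (Nat.mod_modEq _ _)
    refine this.trans ?_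
    unfold Nat.ModEq; rw [mul_comm z]; exact hz.2
  have hvle : v * y' ≤ N' := (Nat.mul_le_mul_right y' hv1.le).trans hle
  obtain ⟨u, hu⟩ := (Nat.modEq_iff_dvd' hvle).mp hv2
  refine ⟨u, v, ?_⟩
  have : N' = x' * u + v * y' := by omega
  rw [hN', hx', hy', this]; ring

section ci
variable {p q : ℕ}

lemma CI_of_pair (k : Type*) [Field k] (hp : 0 < p) (a d n : ℕ) (hn : 3 ≤ n)
    (h : ∀ j, 2 ≤ j → ∃ x y, pqLucas p q (a + j * d)
      = x * pqLucas p q a + y * pqLucas p q (a + d)) :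
    IsCI k (fun i : Fin n => pqLucas p q (a + (i : ℕ) * d)) := by
  apply CI_two _ (by omega)
  · intro i; exact L_pos hp _
  · intro i
    simp only [zero_mul, one_mul, add_zero]
    obtain ⟨j, hj⟩ := i
    rcases Nat.lt_or_ge j 2 with h2 | h2
    · interval_cases j
      · exact ⟨1, 0, by simp⟩
      · exact ⟨0, 1, by simp⟩
    · exact h j h2

lemma CI_odd (k : Type*) [Field k] (hp : 0 < p) (a d n : ℕ) (hn : 3 ≤ n) (hd : Odd d) :
    IsCI k (fun i : Fin n => pqLucas p q (a + (i : ℕ) * d)) := by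
  apply CI_of_pair k hp a d n hn
  intro j hj; clear hj
  induction j using Nat.twoStepInduction with
  | zero => exact ⟨1, 0, by simp⟩
  | one => exact ⟨0, 1, by simp⟩
  | more j h1 h2 =>
    obtain ⟨x1, y1, e1⟩ := h1
    obtain ⟨x2, y2, e2⟩ := h2
    have := L_odd (q := q) hp (a + j * d) d hd
    rw [show a + j * d + 2 * d = a + (j + 2) * d by ring,
      show a + j * d + d = a + (j + 1) * d by ring, e1, e2] at this
    exact ⟨q ^ d * x1 + pqLucas p q d * x2, q ^ d * y1 + pqLucas p q d * y2, by rw [this]; ring⟩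

lemma G_dvd (hp : 0 < p) (a d : ℕ) (D : ℕ) (h0 : D ∣ pqLucas p q a)
    (h1 : D ∣ pqLucas p q (a + d)) (j : ℕ) : D ∣ pqLucas p q (a + j * d) := by
  induction j using Nat.twoStepInduction with
  | zero => simpa using h0
  | one => simpa using h1
  | more j ih1 ih2 =>
    have := L_id (q := q) hp (a + j * d) d
    rw [show a + j * d + 2 * d = a + (j + 2) * d by ring,
      show a + j * d + d = a + (j + 1) * d by ring] at this
    zify at ih1 ih2 ⊢
    have e : (pqLucas p q (a + (j + 2) * d) : ℤ) = pqLucas p q d * pqLucas p q (a + (j + 1) * d)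
      - (-(q:ℤ)) ^ d * pqLucas p q (a + j * d) := by linarith
    rw [e]
    exact dvd_sub (Dvd.dvd.mul_left ih2 _) (Dvd.dvd.mul_left ih1 _)

lemma pair_frob (hp : 0 < p) (a d j : ℕ)
    (h : pqLucas p q a * pqLucas p q (a + d) ≤
      pqLucas p q (a + j * d) * Nat.gcd (pqLucas p q a) (pqLucas p q (a + d))) :
    ∃ x y, pqLucas p q (a + j * d) = x * pqLucas p q a + y * pqLucas p q (a + d) :=
  frob _ _ _ (L_pos hp _) (G_dvd hp a d _ (Nat.gcd_dvd_left _ _) (Nat.gcd_dvd_right _ _) j) h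

lemma CI_b (k : Type*) [Field k] (hp : 0 < p) (hq : 0 < q) (a d n : ℕ) (ha : 0 < a)
    (hn : 3 ≤ n) (hd : Even d) (had : a ≤ d) :
    IsCI k (fun i : Fin n => pqLucas p q (a + (i : ℕ) * d)) := by
  apply CI_of_pair k hp a d n hn
  intro j hj
  have hG : 1 ≤ Nat.gcd (pqLucas p q a) (pqLucas p q (a + d)) :=
    Nat.gcd_pos_of_pos_left _ (L_pos hp _)
  rcases had.lt_or_eq with hlt | rfl
  · apply pair_frob hp
    refine le_trans ?_ (Nat.mul_le_mul_left _ hG)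
    rw [mul_one]
    have hmono : pqLucas p q (a + 2 * d) ≤ pqLucas p q (a + j * d) :=
      L_mono hp hq (by omega) (by nlinarith)
    refine le_trans ?_ hmono
    rcases Nat.even_or_odd a with he | ho
    · have h1 := L_le_prod (q := q) hp a (a + d)
      have h2 : 2 * pqLucas p q (a + (a + d)) < pqLucas p q (a + 2 * d) :=
        L_two' hp hq (by omega) (by obtain ⟨x, hx⟩ := he; obtain ⟨y, hy⟩ := hd; omega)
      omega
    · have h1 := L_odd (q := q) hp d a ho
      have h2 : pqLucas p q (d + 2 * a) ≤ pqLucas p q (a + 2 * d) :=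
        L_mono hp hq (by omega) (by omega)
      rw [add_comm d a] at h1
      omega
  · rcases Nat.lt_or_ge j 3 with h3 | h3
    · have : j = 2 := by omega
      subst this
      obtain ⟨c, hc⟩ := L_dvd (q := q) hp a 3 (by decide)
      exact ⟨c, 0, by rw [show a + 2 * a = a * 3 by ring, hc]; ring⟩
    · apply pair_frob hp
      refine le_trans ?_ (Nat.mul_le_mul_left _ hG)
      rw [mul_one]
      have hmono : pqLucas p q (a + 3 * a) ≤ pqLucas p q (a + j * a) :=
        L_mono hp hq (by omega) (by nlinarith)
      refine le_trans ?_ hmono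
      have h1 := L_le_prod (q := q) hp a (a + a)
      have h2 : 2 * pqLucas p q (a + (a + a)) < pqLucas p q (a + 3 * a) :=
        L_two' hp hq (by omega) (by obtain ⟨x, hx⟩ := hd; omega)
      omega

lemma CI_c (k : Type*) [Field k] (hp : 0 < p) (hq : 0 < q) (g m n : ℕ) (hg : 0 < g)
    (hn : 3 ≤ n) (hge : Even g) (hm : Even m) (hm0 : 0 < m) :
    IsCI k (fun i : Fin n => pqLucas p q (g * (m + 1) + (i : ℕ) * (g * m))) := by
  set a := g * (m + 1) with ha
  set d := g * m with hd
  apply CI_of_pair k hp a d n hn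
  intro j hj
  have hapos : 1 ≤ a := Nat.mul_pos hg (by omega)
  have hdpos : 1 ≤ d := Nat.mul_pos hg hm0
  apply pair_frob hp
  have hLg : pqLucas p q g ∣ Nat.gcd (pqLucas p q a) (pqLucas p q (a + d)) := by
    apply Nat.dvd_gcd
    · exact L_dvd hp g (m + 1) hm.add_one
    · rw [ha, hd, ← mul_add]
      exact L_dvd hp g _ (by obtain ⟨x, hx⟩ := hm; exact ⟨m, by omega⟩)
  have hG := Nat.le_of_dvd (Nat.gcd_pos_of_pos_left _ (L_pos hp _)) hLg
  have hmono : pqLucas p q (a + 2 * d) ≤ pqLucas p q (a + j * d) :=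
    L_mono hp hq (by omega) (by nlinarith)
  refine le_trans ?_ (Nat.mul_le_mul hmono hG)
  have e1 := L_even (q := q) hp d a (hge.mul_right _)
  have e2 := L_even (q := q) hp (3 * d) g hge
  have e3 := L_q (q := q) hp d d hdpos
  have hag : a = d + g := by rw [ha, hd]; ring
  rw [show d + 2 * a = 3 * d + 2 * g by omega, show d + a = a + d by ring] at e1
  rw [show 3 * d + g = a + 2 * d by omega] at e2
  rw [show d + 2 * d = 3 * d by ring] at e3
  have e4 : q ^ a * pqLucas p q d ≤ q ^ g * pqLucas p q (3 * d) := by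
    rw [hag, pow_add, mul_comm (q ^ d), mul_assoc]
    exact Nat.mul_le_mul_left _ e3.le
  nlinarith

lemma CI_de (k : Type*) [Field k] (hp : 0 < p) (hpq : Nat.gcd p q = 1) (d m : ℕ) (hd : 0 < d)
    (hde : Even d) (hm : Odd m) (hT : Odd (pqLucas p q d)) :
    IsCI k (fun i : Fin 3 => pqLucas p q (d * m + (i : ℕ) * d)) := by
  have hmpos := hm.pos
  obtain ⟨u, hu⟩ := L_dvd (q := q) hp d m hm
  obtain ⟨v, hv⟩ := L_dvd (q := q) hp d (m + 2) (by obtain ⟨x, hx⟩ := hm; exact ⟨x + 1, by omega⟩)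
  have hTpos := L_pos (q := q) hp d
  have hmd : 1 ≤ d * m := Nat.mul_pos hd hmpos
  apply CI_three k _ (pqLucas p q d) (q ^ d) u v hTpos
  · have := L_pos (q := q) hp (d * m)
    rw [hu] at this
    exact Nat.pos_of_mul_pos_left this
  · simpa using hu
  · simp only [Fin.val_two]
    rw [← hv]; congr 1; ring
  · have := L_even (q := q) hp (d * m) d hde
    simp
    omega
  · have hgcd : Nat.gcd (d * m) (d * (m + 2)) = d := by
      rw [Nat.gcd_mul_left]
      have : Nat.gcd m (m + 2) = 1 := by
        rw [Nat.gcd_self_add_right]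
        exact (Nat.coprime_two_right.mpr hm)
      rw [this, mul_one]
    obtain ⟨g, m', n', hg, hg1, e1, e2, -, h⟩ := gcdL hp hpq (pqLucas p q d * Nat.gcd u v) (d * m)
      (d * (m + 2)) hmd (by rw [hu]; exact Nat.mul_dvd_mul_left _ (Nat.gcd_dvd_left _ _))
      (by rw [hv]; exact Nat.mul_dvd_mul_left _ (Nat.gcd_dvd_right _ _))
    rw [hgcd] at hg
    subst hg
    have e1 := Nat.eq_of_mul_eq_mul_left hd e1
    have e2 := Nat.eq_of_mul_eq_mul_left hd e2
    subst e1 e2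
    rcases h with ⟨-, -, h⟩ | ⟨h, -⟩
    · have : pqLucas p q g * Nat.gcd u v ∣ pqLucas p q g * 1 := by simpa using h
      exact Nat.dvd_one.mp (Nat.dvd_of_mul_dvd_mul_left hTpos this)
    · exact absurd ⟨hm, by obtain ⟨x, hx⟩ := hm; exact ⟨x + 1, by omega⟩⟩ h
  · simp only [Fin.val_one, one_mul]
    have hgcd : Nat.gcd d (d * (m + 1)) = d := Nat.gcd_mul_right_right _ _
    obtain ⟨g, m', n', hg, hg1, e1, e2, -, h⟩ := gcdL hp hpq
      (Nat.gcd (pqLucas p q d) (pqLucas p q (d * (m + 1)))) d (d * (m + 1)) hd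
      (Nat.gcd_dvd_left _ _) (Nat.gcd_dvd_right _ _)
    rw [hgcd] at hg
    subst hg
    have e2 := Nat.eq_of_mul_eq_mul_left hd e2
    subst e2
    rcases h with ⟨-, h, -⟩ | ⟨-, h⟩
    · exact absurd h (Nat.not_odd_iff_even.mpr hm.add_one)
    · rw [show g * m + g = g * (m + 1) by ring]
      have h3 : Odd (Nat.gcd (pqLucas p q g) (pqLucas p q (g * (m + 1)))) :=
        Odd.of_dvd_nat hT (Nat.gcd_dvd_left _ _)
      rcases (Nat.dvd_prime Nat.prime_two).mp h with h | h
      · exact h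
      · rw [h] at h3; exact absurd h3 (by decide)

end ci

lemma c_iff (a d : ℕ) (hd : 0 < d) (had : d < a) :
    (Nat.gcd a d = a - d ∧ padicValNat 2 a < padicValNat 2 d ∧ 1 ≤ padicValNat 2 a) ↔
    ∃ g m, 0 < g ∧ 0 < m ∧ Even g ∧ Even m ∧ a = g * (m + 1) ∧ d = g * m := by
  have key : ∀ n : ℕ, n ≠ 0 → (1 ≤ padicValNat 2 n ↔ Even n) := by
    intro n hn
    rw [even_iff_two_dvd, dvd_iff_padicValNat_ne_zero hn]; omega
  constructor
  · rintro ⟨h1, h2, h3⟩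
    obtain ⟨m, hm⟩ : a - d ∣ d := by rw [← h1]; exact Nat.gcd_dvd_right _ _
    set g := a - d with hg
    have hg0 : 0 < g := by omega
    have ha : a = g * (m + 1) := by rw [mul_add, ← hm]; omega
    have hm0 : 0 < m := Nat.pos_of_ne_zero (by rintro rfl; simp at hm; omega)
    rw [ha, padicValNat.mul (by omega) (by omega)] at h2 h3
    rw [hm, padicValNat.mul (by omega) (by omega)] at h2
    have hme : Even m := (key m (by omega)).mp (by omega)
    have : ¬ 1 ≤ padicValNat 2 (m + 1) := by
      rw [key _ (by omega), Nat.not_even_iff_odd]; exact hme.add_one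
    exact ⟨g, m, hg0, hm0, (key g (by omega)).mp (by omega), hme, ha, hm⟩
  · rintro ⟨g, m, hg0, hm0, hge, hme, rfl, rfl⟩
    have h1 : ¬ 1 ≤ padicValNat 2 (m + 1) := by
      rw [key _ (by omega), Nat.not_even_iff_odd]; exact hme.add_one
    have h2 := (key g (by omega)).mpr hge
    have h3 := (key m (by omega)).mpr hme
    refine ⟨?_, ?_, ?_⟩
    · rw [Nat.gcd_mul_left]; simp [mul_add]
    · rw [padicValNat.mul (by omega) (by omega), padicValNat.mul (by omega) (by omega)]; omega
    · rw [padicValNat.mul (by omega) (by omega)]; omega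

lemma CI_dir (k : Type*) [Field k] (p q : ℕ) (hp : 0 < p) (hq : 0 < q)
    (hpq : Nat.gcd p q = 1) (a d : ℕ) (ha : 0 < a) (hd : 0 < d)
    (n : ℕ) (hn : 3 ≤ n)
    (h : (Odd d ∨ a ≤ d ∨
        (Nat.gcd a d = a - d ∧ padicValNat 2 a < padicValNat 2 d ∧
          1 ≤ padicValNat 2 a) ∨
        (n = 3 ∧ d ∣ a ∧ Odd (a / d) ∧ Odd p ∧ Even q) ∨
        (n = 3 ∧ d ∣ a ∧ ¬ (3 ∣ d) ∧ Odd p ∧ Odd q ∧ Odd (a / d)))) :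
    IsCI k (fun i : Fin n => pqLucas p q (a + (i : ℕ) * d)) := by
  rcases Nat.even_or_odd d with hde | hdo
  swap
  · exact CI_odd k hp a d n hn hdo
  rcases Nat.lt_or_ge d a with had | had
  swap
  · exact CI_b k hp hq a d n ha hn hde had
  rcases h with h | h | h | ⟨rfl, ⟨m, rfl⟩, hm, h1, h2⟩ | ⟨rfl, ⟨m, rfl⟩, h3, h1, h2, hm⟩
  · exact absurd h (Nat.not_odd_iff_even.mpr hde)
  · omega
  · obtain ⟨g, m, hg0, hm0, hge, hme, rfl, rfl⟩ := (c_iff a d hd had).mp h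
    exact CI_c k hp hq g m n hg0 hn hge hme hm0
  · rw [Nat.mul_div_cancel_left _ hd] at hm
    exact CI_de k hp hpq d m hd hde hm (L_parity1 h1 h2 d hd)
  · rw [Nat.mul_div_cancel_left _ hd] at hm
    refine CI_de k hp hpq d m hd hde hm ?_
    rw [← Nat.not_even_iff_odd, L_parity2 h1 h2]; exact h3

section comb
variable {n : ℕ}

lemma wt_erase (d : Fin n → ℕ) (m : Fin n →₀ ℕ) (i : Fin n) :
    wt d (m.erase i) + m i * d i = wt d m := by
  conv_rhs => rw [← Finsupp.erase_add_single i m, wt_add, wt_single]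

lemma wt_le (d : Fin n → ℕ) (m : Fin n →₀ ℕ) (i : Fin n) : m i * d i ≤ wt d m := by
  have := wt_erase d m i; omega

lemma eq_zero_of_wt (d : Fin n → ℕ) (hd : ∀ i, 0 < d i) (m : Fin n →₀ ℕ) (h : wt d m = 0) :
    m = 0 := by
  by_contra hm
  have := wt_pos d hd m hm; omega

lemma eq_single_of_wt (d : Fin n → ℕ) (hd : ∀ i, 0 < d i) (m : Fin n →₀ ℕ) (i : Fin n) (c : ℕ)
    (h : wt d m = c * d i) (hc : c ≤ m i) : m = Finsupp.single i c := by
  have h1 := wt_erase d m i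
  have h2 : c * d i ≤ m i * d i := Nat.mul_le_mul_right _ hc
  have h3 := eq_zero_of_wt d hd (m.erase i) (by omega)
  rw [← Finsupp.erase_add_single i m, h3, zero_add]
  have h4 : wt d (m.erase i) = 0 := by rw [h3, wt_zero]
  have : m i = c := Nat.eq_of_mul_eq_mul_right (hd i) (by omega)
  rw [this]

lemma critical (d : Fin n → ℕ) (hd : ∀ i, 0 < d i) (hn : 2 ≤ n) (i : Fin n) :
    ∃ c, ∃ w : Fin n →₀ ℕ, 0 < c ∧ w i = 0 ∧ wt d w = c * d i ∧ Iso d (Finsupp.single i c) ∧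
      ∀ c' w', 0 < c' → w' i = 0 → wt d w' = c' * d i → c ≤ c' := by
  classical
  have hex : ∃ c, 0 < c ∧ ∃ w : Fin n →₀ ℕ, w i = 0 ∧ wt d w = c * d i := by
    obtain ⟨j, hj⟩ : ∃ j, j ≠ i := by
      have : Nontrivial (Fin n) := Fin.nontrivial_iff_two_le.mpr hn
      exact exists_ne i
    refine ⟨d j, hd j, Finsupp.single j (d i), ?_, ?_⟩
    · rw [Finsupp.single_eq_of_ne hj.symm]
    · rw [wt_single, mul_comm]
  have hmin : ∀ c' w', 0 < c' → w' i = 0 → wt d w' = c' * d i → Nat.find hex ≤ c' :=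
    fun c' w' h1 h2 h3 => Nat.find_min' hex ⟨h1, w', h2, h3⟩
  obtain ⟨h1, w, h2, h3⟩ := Nat.find_spec hex
  refine ⟨Nat.find hex, w, h1, h2, h3, ?_, hmin⟩
  set c := Nat.find hex
  intro m' hm' hne l
  by_cases hl : l = i
  · subst hl
    right
    by_contra h0
    rw [wt_single] at hm'
    have h4 : m' l < c := by
      by_contra hcon
      exact hne (eq_single_of_wt d hd m' l c hm' (by omega))
    have h5 := wt_erase d m' l
    have := hmin (c - m' l) (m'.erase l) (by omega) (by simp) (by
      rw [Nat.sub_mul]; omega)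
    omega
  · left; rw [Finsupp.single_eq_of_ne hl]

/-- choices of critical monomials and factorizations. -/
lemma comb_choice (u : ℕ → ℕ) (T Q : ℕ) (hn : 3 ≤ n) (upos : ∀ i, 0 < u i) (hT : 0 < T) (hQ : 0 < Q)
    (hrec : ∀ j, u (j + 2) + Q * u j = T * u (j + 1))
    (CL : ∀ i j c b, 1 ≤ i → i + 2 ≤ n → j < n → j ≠ i → 0 < c → c * u i = b * u j → T ≤ c) :
    ∃ (c : Fin n → ℕ) (w : Fin n → (Fin n →₀ ℕ)), (∀ i, 0 < c i) ∧ (∀ i, w i i = 0) ∧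
      (∀ i, wt (fun i : Fin n => u i) (w i) = c i * u i) ∧
      (∀ i, Iso (fun i : Fin n => u i) (Finsupp.single i (c i))) ∧
      (∀ (i : Fin n) c' w', 0 < c' → w' i = 0 → wt (fun i : Fin n => u i) w' = c' * u i → c i ≤ c') ∧
      (∀ i : Fin n, 1 ≤ (i : ℕ) → (i : ℕ) + 2 ≤ n → c i ≤ T ∧
        (c i = T → ∀ l : Fin n, w i l = (if (l : ℕ) + 1 = i then Q else 0) +
          (if (l : ℕ) = i + 1 then 1 else 0)) ∧ ∀ j b, w i ≠ Finsupp.single j b) := by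
  classical
  set D : Fin n → ℕ := fun i => u i with hD
  choose c w h1 h2 h3 h4 h5 using critical D (fun i => upos i) (by omega)
  have hsp : ∀ i : Fin n, 1 ≤ (i : ℕ) → (i : ℕ) + 2 ≤ n → ∃ s : Fin n →₀ ℕ,
      (∀ l : Fin n, s l = (if (l : ℕ) + 1 = i then Q else 0) +
          (if (l : ℕ) = i + 1 then 1 else 0)) ∧ wt D s = T * u i := by
    intro i hi1 hi2
    refine ⟨Finsupp.single ⟨i - 1, by omega⟩ Q + Finsupp.single ⟨i + 1, by omega⟩ 1, ?_, ?_⟩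
    · intro l
      simp only [Finsupp.add_apply, Finsupp.single_apply, Fin.ext_iff]
      congr 1
      · congr 1; apply propext; omega
      · congr 1; apply propext; omega
    · rw [wt_add, wt_single, wt_single]
      have := hrec (i - 1)
      rw [show (i:ℕ) - 1 + 2 = i + 1 by omega, show (i:ℕ) - 1 + 1 = i by omega] at this
      simp only [hD]; omega
  choose s hs1 hs2 using hsp
  refine ⟨c, fun i => if h : 1 ≤ (i : ℕ) ∧ (i : ℕ) + 2 ≤ n ∧ c i = T then s i h.1 h.2.1 else w i,
    h1, ?_, ?_, h4, h5, ?_⟩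
  · intro i
    dsimp only
    split_ifs with h
    · rw [hs1, if_neg (by omega), if_neg (by omega)]
    · exact h2 i
  · intro i
    dsimp only
    split_ifs with h
    · rw [hs2, h.2.2]
    · exact h3 i
  · intro i hi1 hi2
    refine ⟨h5 i T (s i hi1 hi2) hT (by rw [hs1, if_neg (by omega), if_neg (by omega)]) (hs2 i hi1 hi2), ?_, ?_⟩
    · intro hc l
      dsimp only
      rw [dif_pos ⟨hi1, hi2, hc⟩, hs1]
    · intro j b
      dsimp only
      split_ifs with h
      · intro hh
        have e1 := hs1 i hi1 hi2 ⟨i - 1, by omega⟩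
        have e2 := hs1 i hi1 hi2 ⟨i + 1, by omega⟩
        rw [hh, if_pos (by simp; omega)] at e1
        rw [hh, if_pos rfl] at e2
        by_cases g1 : j = ⟨i - 1, by omega⟩
        · rw [Finsupp.single_eq_of_ne (by rw [g1]; simp [Fin.ext_iff]; omega)] at e2
          omega
        · rw [Finsupp.single_eq_of_ne (fun h => g1 h.symm)] at e1
          omega
      · intro hh
        have e := h3 i
        rw [hh, wt_single] at e
        have hbne : b ≠ 0 := by
          rintro rfl
          have := Nat.mul_pos (h1 i) (upos i); simp only [hD] at e; omega
        have hji : (j : ℕ) ≠ i := by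
          intro hji
          have := h2 i
          rw [hh, ← Fin.ext hji, Finsupp.single_eq_same] at this
          exact hbne this
        have h6 := CL i j (c i) b hi1 hi2 j.2 hji (h1 i) e.symm
        have h7 := h5 i T (s i hi1 hi2) hT (by rw [hs1, if_neg (by omega), if_neg (by omega)]) (hs2 i hi1 hi2)
        exact h ⟨hi1, hi2, by omega⟩


lemma comb (k : Type*) [Field k] (u W : ℕ → ℕ) (T Q D1 : ℕ) (hn : 3 ≤ n) (upos : ∀ i, 0 < u i)
    (ustrict : StrictMono u) (hT : 0 < T) (hQ : 0 < Q)
    (hrec : ∀ j, u (j + 2) + Q * u j = T * u (j + 1))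
    (W0 : W 0 = 0) (W1 : W 1 = 1) (Wrec : ∀ j, W (j + 2) + Q * W j = T * W (j + 1))
    (Wstrict : StrictMono W) (hTQ : ¬ T ∣ Q)
    (E1 : ∀ i j, i < j → u j * W i < u i * W j)
    (TL : ∀ m m' : Fin n →₀ ℕ, wt (fun i : Fin n => u i) m = wt (fun i : Fin n => u i) m' →
      wt (fun i : Fin n => W i) m ≠ wt (fun i : Fin n => W i) m' →
      D1 * u 0 ≤ wt (fun i : Fin n => u i) m)
    (CL : ∀ i j c b, 1 ≤ i → i + 2 ≤ n → j < n → j ≠ i → 0 < c → c * u i = b * u j → T ≤ c)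
    (hD1 : 0 < D1) (hD : u 0 ∣ D1 * u 1)
    (case2 : ∀ c b, 0 < c → c * u 0 = b * u (n - 1) → c * u 0 ≤ D1 * u 1 →
      4 ≤ n ∧ W 3 * u 1 < D1 * u 0) :
    NCI k (fun i : Fin n => u i) := by
  classical
  obtain ⟨c, w, h1, h2, h3, h4, h5, h6⟩ := comb_choice (n := n) u T Q hn upos hT hQ hrec CL
  set D : Fin n → ℕ := fun i => u i with hDdef
  set V : Fin n → ℕ := fun i => W i with hVdef
  have Dpos : ∀ i, 0 < D i := fun i => upos i
  set z : Fin n := ⟨0, by omega⟩ with hz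
  set t : Fin n := ⟨n - 1, by omega⟩ with ht
  have hzt : z ≠ t := by simp [hz, ht, Fin.ext_iff]; omega
  have hmid : ∀ i : Fin n, i ≠ z → i ≠ t → 1 ≤ (i : ℕ) ∧ (i : ℕ) + 2 ≤ n := by
    intro i hi1 hi2
    simp only [hz, ht, ne_eq, Fin.ext_iff] at hi1 hi2
    have := i.2
    omega
  have hne : ∀ i j b, j ≠ i → w i = Finsupp.single j b → b ≠ 0 := by
    intro i j b hji he hb
    have := h3 i
    rw [he, hb, Finsupp.single_zero, wt_zero] at this
    have := Nat.mul_pos (h1 i) (upos i)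
    omega
  have hself : ∀ i, w i ≠ Finsupp.single i (c i) := by
    intro i he
    have := h2 i
    rw [he, Finsupp.single_eq_same] at this
    have := h1 i; omega
  by_cases hc2 : c z * u 0 = c t * u (n - 1)
  swap
  · refine NCI_of_comb D (fun i => Finsupp.single i (c i)) w
      (fun i => if i = z ∨ i = t then 1 else 0) ?_ h4 ?_ ?_
    · intro i j hij
      exact ((Finsupp.single_eq_single_iff _ _ _ _).mp hij).elim (fun h => h.1)
        (fun h => absurd h.1 (h1 i).ne')
    · intro i; rw [wt_single]; exact h3 i
    · intro i j hij
      have hd : i ≠ j := by rintro rfl; exact hself i hij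
      have hi : i = z ∨ i = t := by
        by_contra hcon
        push Not at hcon
        obtain ⟨g1, g2⟩ := hmid i hcon.1 hcon.2
        exact (h6 i g1 g2).2.2 j (c j) hij
      rw [if_pos hi, if_neg]
      · norm_num
      · rintro hj
        have h3i := h3 i
        rw [hij, wt_single] at h3i
        rcases hi with rfl | rfl <;> rcases hj with rfl | rfl
        · exact hd rfl
        · exact hc2 h3i.symm
        · exact hc2 h3i
        · exact hd rfl
  · -- case 2
    have hle : c z * u 0 ≤ D1 * u 1 := by
      obtain ⟨e, he⟩ := hD
      have := h5 z e (Finsupp.single ⟨1, by omega⟩ D1) (by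
        apply Nat.pos_of_ne_zero; rintro rfl
        have := Nat.mul_pos hD1 (upos 1); omega)
        (by rw [Finsupp.single_eq_of_ne]; simp [hz, Fin.ext_iff])
        (by rw [wt_single]; simp only [hDdef, hz]; rw [he, mul_comm])
      rw [he, mul_comm (u 0)]
      exact Nat.mul_le_mul_right _ this
    obtain ⟨hn4, hW3⟩ := case2 (c z) (c t) (h1 z) hc2 hle
    set f : Fin n := ⟨3, by omega⟩ with hf
    have hzf : z ≠ f := by simp [hz, hf, Fin.ext_iff]
    have hW2 : W 2 = T := by have := Wrec 0; simp [W0, W1] at this; exact this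
    have hW3' : W 3 + Q = T * T := by have := Wrec 1; simp [W1, hW2] at this; exact this
    have hu3 : u 3 + Q * T * u 0 = W 3 * u 1 := by
      have e1 := hrec 0
      have e2 := hrec 1
      simp only [zero_add, Nat.reduceAdd] at e1 e2
      zify at e1 e2 hW3' ⊢
      linear_combination e2 + T * e1 - u 1 * hW3'
    have hVpos : ∀ i, i ≠ z → 0 < V i := by
      intro i hi
      have : 0 < (i : ℕ) := Nat.pos_of_ne_zero (fun h => hi (Fin.ext h))
      have := Wstrict this
      rw [W0] at this; exact this
    -- degree-zero W sums
    have hVzero : ∀ m : Fin n →₀ ℕ, wt V m = 0 → m = Finsupp.single z (m z) := by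
      intro m hm
      ext l
      by_cases hl : l = z
      · rw [hl, Finsupp.single_eq_same]
      · rw [Finsupp.single_eq_of_ne hl]
        have := wt_le V m l
        have h' := hVpos l hl
        by_contra h0
        have := Nat.mul_pos (Nat.pos_of_ne_zero h0) h'
        omega
    have hc0 : D1 * u 0 ≤ c z * u 0 := by
      have := TL (Finsupp.single z (c z)) (w z) (by rw [wt_single]; exact (h3 z).symm) (by
        rw [wt_single]
        intro he
        have hV : V z = 0 := W0
        rw [hV, mul_zero] at he
        have e := hVzero _ he.symm
        rw [h2 z, Finsupp.single_zero] at e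
        have := h3 z
        rw [e, wt_zero] at this
        have := Nat.mul_pos (h1 z) (upos z); omega)
      rw [wt_single] at this
      exact this
    have hex : ∃ A, ∃ m' : Fin n →₀ ℕ, wt D m' = A * u 0 + u 3 ∧
        m' ≠ Finsupp.single z A + Finsupp.single f 1 := by
      refine ⟨Q * T, Finsupp.single ⟨1, by omega⟩ (W 3), ?_, ?_⟩
      · rw [wt_single, ← hu3.trans rfl, add_comm]
      · intro he
        have := DFunLike.congr_fun he f
        rw [Finsupp.single_eq_of_ne (by simp [hf, Fin.ext_iff])] at this
        simp at this
    set A := Nat.find hex with hA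
    obtain ⟨wl, hwl1, hwl2⟩ := Nat.find_spec hex
    rw [← hA] at hwl1 hwl2
    have hAle : A ≤ Q * T := by
      apply Nat.find_min' hex
      refine ⟨Finsupp.single ⟨1, by omega⟩ (W 3), ?_, ?_⟩
      · rw [wt_single, ← hu3.trans rfl, add_comm]
      · intro he
        have := DFunLike.congr_fun he f
        rw [Finsupp.single_eq_of_ne (by simp [hf, Fin.ext_iff])] at this
        simp at this
    have hdeg : A * u 0 + u 3 < D1 * u 0 := by
      have := Nat.mul_le_mul_right (u 0) hAle
      omega
    have hwtM : wt D (Finsupp.single z A + Finsupp.single f 1) = A * u 0 + u 3 := by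
      rw [wt_add, wt_single, wt_single, one_mul]
    have hVM : wt V (Finsupp.single z A + Finsupp.single f 1) = W 3 := by
      rw [wt_add, wt_single, wt_single, one_mul]
      simp [hVdef, hz, hf, W0]
    have hMiso : Iso D (Finsupp.single z A + Finsupp.single f 1) := by
      intro m' hm' hne' l
      rw [hwtM] at hm'
      by_contra hcon
      push Not at hcon
      obtain ⟨hl1, hl2⟩ := hcon
      have hle1 : Finsupp.single l 1 ≤ m' := Finsupp.single_le_iff.mpr (Nat.pos_of_ne_zero hl2)
      obtain ⟨m'', rfl⟩ := exists_add_of_le hle1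
      rw [wt_add, wt_single, one_mul] at hm'
      by_cases hl : l = z
      · subst hl
        have hA0 : 0 < A := by
          apply Nat.pos_of_ne_zero
          rintro h0
          rw [h0] at hl1
          simp [hzf.symm] at hl1
        apply Nat.find_min hex (m := A - 1) (by omega)
        refine ⟨m'', ?_, ?_⟩
        · have : A * u 0 = (A - 1) * u 0 + u 0 := by
            conv_lhs => rw [← Nat.sub_add_cancel hA0]
            ring
          have hDz : D z = u 0 := rfl
          omega
        · rintro rfl
          apply hne'
          rw [← add_assoc, ← Finsupp.single_add, Nat.add_sub_cancel' hA0]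
      · by_cases hlf : l = f
        · subst hlf
          have hDf : D f = u 3 := rfl
          have hm2 : wt D m'' = A * u 0 := by omega
          by_cases hV : wt V (Finsupp.single z A) = wt V m''
          · rw [wt_single] at hV
            have hV0 : V z = 0 := W0
            rw [hV0, mul_zero] at hV
            have e := hVzero _ hV.symm
            rw [e, wt_single] at hm2
            have : m'' z = A := Nat.eq_of_mul_eq_mul_right (upos 0) hm2
            apply hne'
            rw [e, this, add_comm]
          · have := TL _ _ (by rw [wt_single, hm2]) hV
            rw [wt_single] at this
            have hDz : D z = u 0 := rfl
            rw [hDz] at this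
            omega
        · apply hl1
          rw [Finsupp.add_apply, Finsupp.single_eq_of_ne hl, Finsupp.single_eq_of_ne hlf,
            add_zero]
    have hA0 : A ≠ 0 := by
      intro hA0
      rw [hA0] at hwl1 hwl2 hwtM hVM
      have hVeq : wt V wl = W 3 := by
        by_contra hcon
        have := TL wl (Finsupp.single z 0 + Finsupp.single f 1) (by rw [hwl1, hwtM])
          (by rw [hVM]; exact hcon)
        rw [hwl1] at this
        rw [hA0] at hdeg
        omega
      rw [zero_mul, zero_add] at hwl1
      apply hwl2
      rw [Finsupp.single_zero, zero_add]
      apply eq_single_of_wt D Dpos wl f 1 (by rw [hwl1, one_mul])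
      by_contra hlt
      have hwf : wl f = 0 := by omega
      have hsum : ∑ i, wl i * (u i * W 3) = ∑ i, wl i * (u 3 * W i) := by
        have e1 : ∑ i, wl i * (u i * W 3) = wt D wl * W 3 := by
          rw [wt, Finset.sum_mul]; exact Finset.sum_congr rfl fun i _ => by simp only [hDdef]; ring
        have e2 : ∑ i, wl i * (u 3 * W i) = wt V wl * u 3 := by
          rw [wt, Finset.sum_mul]; exact Finset.sum_congr rfl fun i _ => by simp only [hVdef]; ring
        rw [e1, e2, hwl1, hVeq, mul_comm]
      have hz3 : ∀ i : Fin n, 3 ≤ (i : ℕ) → wl i = 0 := by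
        intro i hi
        rcases hi.eq_or_lt with h | h
        · rw [show i = f from Fin.ext h.symm, hwf]
        · by_contra h0
          have e1 := wt_le D wl i
          have e2 := ustrict h
          have e3 : D i ≤ wl i * D i := Nat.le_mul_of_pos_left _ (Nat.pos_of_ne_zero h0)
          have e4 : D i = u i := rfl
          omega
      have hall : ∀ i, wl i * (u 3 * W i) = wl i * (u i * W 3) := by
        intro i
        refine (Finset.sum_eq_sum_iff_of_le (s := Finset.univ) (f := fun i => wl i * (u 3 * W i))
          (g := fun i => wl i * (u i * W 3)) ?_).mp hsum.symm i (Finset.mem_univ i)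
        intro i _
        rcases Nat.lt_or_ge (i : ℕ) 3 with h | h
        · exact Nat.mul_le_mul_left _ (E1 i 3 h).le
        · simp [hz3 i h]
      have hw0 : wl = 0 := by
        ext i
        rcases Nat.lt_or_ge (i : ℕ) 3 with h | h
        · by_contra h0
          have := Nat.eq_of_mul_eq_mul_left (Nat.pos_of_ne_zero h0) (hall i)
          have := E1 i 3 h
          omega
        · exact hz3 i h
      rw [hw0, wt_zero] at hwl1
      have := upos 3; omega
    refine NCI_of_comb D
      (fun i => if i = t then Finsupp.single z A + Finsupp.single f 1 else Finsupp.single i (c i))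
      (fun i => if i = t then wl else w i)
      (fun i => if i = z ∨ i = t then 1 else 0) ?_ ?_ ?_ ?_
    · have aux : ∀ j, Finsupp.single z A + Finsupp.single f 1 ≠ Finsupp.single j (c j) := by
        intro j he
        have e1 := DFunLike.congr_fun he z
        have e2 := DFunLike.congr_fun he f
        rw [Finsupp.add_apply, Finsupp.single_eq_same, Finsupp.single_eq_of_ne hzf, add_zero] at e1
        rw [Finsupp.add_apply, Finsupp.single_eq_same, Finsupp.single_eq_of_ne hzf.symm, zero_add] at e2
        by_cases hj : j = z
        · rw [hj, Finsupp.single_eq_of_ne hzf.symm] at e2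
          omega
        · rw [Finsupp.single_eq_of_ne (Ne.symm hj)] at e1
          omega
      intro i j hij
      dsimp only at hij
      split_ifs at hij with g1 g2 g2
      · rw [g1, g2]
      · exact absurd hij (aux j)
      · exact absurd hij.symm (aux i)
      · exact ((Finsupp.single_eq_single_iff _ _ _ _).mp hij).elim (fun h => h.1)
          (fun h => absurd h.1 (h1 i).ne')
    · intro i
      split_ifs
      · exact hMiso
      · exact h4 i
    · intro i
      split_ifs
      · rw [hwl1, hwtM]
      · rw [wt_single]; exact h3 i
    · intro i j hij
      by_cases hi : i = t
      · rw [if_pos hi] at hij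
        rw [if_pos (Or.inr hi), if_neg]
        · norm_num
        · rintro (rfl | rfl)
          · rw [if_neg hzt] at hij
            rw [hij, wt_single] at hwl1
            have hDz : D z = u 0 := rfl
            rw [hDz] at hwl1
            omega
          · rw [if_pos rfl] at hij
            exact hwl2 hij
      · rw [if_neg hi] at hij
        by_cases hiz : i = z
        · rw [if_pos (Or.inl hiz), if_neg]
          · norm_num
          · rintro (rfl | rfl)
            · rw [if_neg hzt, hiz] at hij
              exact hself _ hij
            · rw [if_pos rfl] at hij
              have := h3 i
              rw [hij, hwtM, hiz] at this
              have hzz : u (z : ℕ) = u 0 := rfl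
              rw [hzz] at this
              omega
        · exfalso
          obtain ⟨g1, g2⟩ := hmid i hiz hi
          obtain ⟨k1, k2, k3⟩ := h6 i g1 g2
          by_cases hj : j = t
          swap
          · rw [if_neg hj] at hij
            exact k3 j (c j) hij
          rw [if_pos hj] at hij
          have hd := h3 i
          rw [hij, hwtM] at hd
          by_cases hcT : c i = T
          · have e := k2 hcT
            have e1 := e ⟨i + 1, by omega⟩
            rw [hij, if_neg (by simp; omega), if_pos rfl, Finsupp.add_apply,
              Finsupp.single_eq_of_ne (by simp [hz, Fin.ext_iff]), zero_add] at e1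
            have e2 : (i : ℕ) = 2 := by
              by_contra hcon
              rw [Finsupp.single_eq_of_ne (by simp [hf, Fin.ext_iff]; omega)] at e1
              omega
            have e3 := e ⟨1, by omega⟩
            rw [hij, if_pos (by simp [e2]), Finsupp.add_apply,
              Finsupp.single_eq_of_ne (by simp [hz, Fin.ext_iff]),
              Finsupp.single_eq_of_ne (by simp [hf, Fin.ext_iff])] at e3
            omega
          · have hVi : c i * W i = W 3 := by
              by_contra hcon
              have := TL (w i) (Finsupp.single i (c i)) (by rw [h3, wt_single])
                (by rw [hij, hVM, wt_single]; exact fun h => hcon h.symm)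
              rw [hij, hwtM] at this
              omega
            have hcpos := h1 i
            have hT3 := Wstrict (show 2 < 3 by norm_num)
            rcases Nat.lt_or_ge 3 (i : ℕ) with h | h
            · have := Wstrict h
              have := Nat.le_mul_of_pos_left (W i) hcpos
              omega
            · obtain h | h | h : (i : ℕ) = 1 ∨ (i : ℕ) = 2 ∨ (i : ℕ) = 3 := by omega
              · rw [h, W1, mul_one] at hVi
                omega
              · rw [h, hW2] at hVi
                apply hTQ
                rw [← hVi] at hW3'
                exact (Nat.dvd_add_right (Dvd.intro_left _ rfl)).mp (hW3' ▸ Dvd.intro _ rfl)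
              · have e1 := h2 i
                rw [hij, show i = f from Fin.ext h] at e1
                simp at e1

end comb

section seqs

lemma seq_E1 (u W : ℕ → ℕ) (T Q : ℕ) (upos : ∀ i, 0 < u i) (hQ : 0 < Q)
    (hrec : ∀ j, u (j + 2) + Q * u j = T * u (j + 1))
    (W0 : W 0 = 0) (W1 : W 1 = 1) (Wrec : ∀ j, W (j + 2) + Q * W j = T * W (j + 1))
    (i j : ℕ) (hij : i < j) : u j * W i < u i * W j := by
  have hdet : ∀ i, u (i + 1) * W i < u i * W (i + 1) := by
    intro i
    induction i with
    | zero => simp [W0, W1, upos 0]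
    | succ i ih =>
      have e1 := hrec i
      have e2 := Wrec i
      have e3 : Q * (u (i + 1) * W i) < Q * (u i * W (i + 1)) := Nat.mul_lt_mul_of_pos_left ih hQ
      rw [show i + 1 + 1 = i + 2 from rfl]
      zify at *
      have : (u (i+1) : ℤ) * W (i+2) - u (i+2) * W (i+1) = Q * (u i * W (i+1)) - Q * (u (i+1) * W i) := by
        linear_combination (u (i+1) : ℤ) * e2 - W (i+1) * e1
      linarith
  induction j, hij using Nat.le_induction with
  | base => exact hdet i
  | succ j hj ih =>
    have h1 : u (j + 1) * (u j * W i) ≤ u (j + 1) * (u i * W j) := Nat.mul_le_mul_left _ ih.le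
    have h2 : u i * (u (j + 1) * W j) < u i * (u j * W (j + 1)) :=
      Nat.mul_lt_mul_of_pos_left (hdet j) (upos i)
    have : u j * (u (j + 1) * W i) < u j * (u i * W (j + 1)) := by nlinarith
    exact Nat.lt_of_mul_lt_mul_left this

lemma seq_cong (u W : ℕ → ℕ) (T Q : ℕ)
    (hrec : ∀ j, u (j + 2) + Q * u j = T * u (j + 1))
    (W0 : W 0 = 0) (W1 : W 1 = 1) (Wrec : ∀ j, W (j + 2) + Q * W j = T * W (j + 1))
    (i : ℕ) : u 1 * W i ≡ u i [MOD u 0] := by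
  induction i using Nat.twoStepInduction with
  | zero => simp [W0, Nat.ModEq]
  | one => simp [W1, Nat.ModEq]
  | more i h1 h2 =>
    have e : u 1 * W (i + 2) + Q * (u 1 * W i) = T * (u 1 * W (i + 1)) := by
      have := Wrec i
      linear_combination u 1 * this
    have h3 : u 1 * W (i + 2) + Q * (u 1 * W i) ≡ u (i + 2) + Q * u i [MOD u 0] := by
      rw [e, hrec]; exact h2.mul_left _
    exact Nat.ModEq.add_right_cancel (h1.mul_left _) h3

lemma seq_cong_wt {n : ℕ} (u W : ℕ → ℕ) (T Q : ℕ)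
    (hrec : ∀ j, u (j + 2) + Q * u j = T * u (j + 1))
    (W0 : W 0 = 0) (W1 : W 1 = 1) (Wrec : ∀ j, W (j + 2) + Q * W j = T * W (j + 1))
    (m : Fin n →₀ ℕ) :
    u 1 * wt (fun i : Fin n => W i) m ≡ wt (fun i : Fin n => u i) m [MOD u 0] := by
  unfold wt
  rw [Finset.mul_sum]
  have : ∀ s : Finset (Fin n), ∑ i ∈ s, u 1 * (m i * W i) ≡ ∑ i ∈ s, m i * u i [MOD u 0] := by
    intro s
    classical
    induction s using Finset.induction_on with
    | empty => rfl
    | insert a s ha ih =>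
      rw [Finset.sum_insert ha, Finset.sum_insert ha]
      refine Nat.ModEq.add ?_ ih
      rw [mul_left_comm]
      exact (seq_cong u W T Q hrec W0 W1 Wrec a).mul_left _
  exact this _

lemma seq_canc (u : ℕ → ℕ) (upos : ∀ i, 0 < u i) (x y : ℕ) (h : u 1 * x ≡ u 1 * y [MOD u 0]) :
    x ≡ y [MOD u 0 / Nat.gcd (u 0) (u 1)] :=
  Nat.ModEq.cancel_left_div_gcd (upos 0) h

lemma seq_TL {n : ℕ} (u W : ℕ → ℕ) (T Q : ℕ) (upos : ∀ i, 0 < u i)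
    (hrec : ∀ j, u (j + 2) + Q * u j = T * u (j + 1))
    (W0 : W 0 = 0) (W1 : W 1 = 1) (Wrec : ∀ j, W (j + 2) + Q * W j = T * W (j + 1))
    (E2 : ∀ i, W i * u 0 ≤ u i)
    (m m' : Fin n →₀ ℕ) (h : wt (fun i : Fin n => u i) m = wt (fun i : Fin n => u i) m')
    (hne : wt (fun i : Fin n => W i) m ≠ wt (fun i : Fin n => W i) m') :
    u 0 / Nat.gcd (u 0) (u 1) * u 0 ≤ wt (fun i : Fin n => u i) m := by
  have hb : ∀ m : Fin n →₀ ℕ, wt (fun i : Fin n => W i) m * u 0 ≤ wt (fun i : Fin n => u i) m := by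
    intro m
    unfold wt
    rw [Finset.sum_mul]
    refine Finset.sum_le_sum fun i _ => ?_
    rw [mul_assoc]
    exact Nat.mul_le_mul_left _ (E2 i)
  have hmod := seq_canc u upos _ _ ((seq_cong_wt u W T Q hrec W0 W1 Wrec m).trans
    (h ▸ (seq_cong_wt u W T Q hrec W0 W1 Wrec m').symm))
  set D1 := u 0 / Nat.gcd (u 0) (u 1)
  rcases Nat.lt_or_gt_of_ne hne with hlt | hlt
  · have h1 := Nat.le_of_dvd (by omega) ((Nat.modEq_iff_dvd' hlt.le).mp hmod)
    rw [h]
    exact (Nat.mul_le_mul_right _ (by omega)).trans (hb m')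
  · have h1 := Nat.le_of_dvd (by omega) ((Nat.modEq_iff_dvd' hlt.le).mp hmod.symm)
    exact (Nat.mul_le_mul_right _ (by omega)).trans (hb m)

lemma seq_red {n : ℕ} (u W : ℕ → ℕ) (T Q : ℕ) (upos : ∀ i, 0 < u i) (hQ : 0 < Q)
    (hrec : ∀ j, u (j + 2) + Q * u j = T * u (j + 1))
    (W0 : W 0 = 0) (W1 : W 1 = 1) (Wrec : ∀ j, W (j + 2) + Q * W j = T * W (j + 1))
    (m : Fin n →₀ ℕ) (h : wt (fun i : Fin n => u i) m = u n) :
    u 0 / Nat.gcd (u 0) (u 1) ≤ W n := by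
  have hlt : wt (fun i : Fin n => W i) m < W n := by
    have h1 : u n * wt (fun i : Fin n => W i) m < u n * W n := by
      have hm : m ≠ 0 := by
        rintro rfl; rw [wt_zero] at h; have := upos n; omega
      obtain ⟨l, hl⟩ := Finsupp.ne_iff.mp hm
      calc u n * wt (fun i : Fin n => W i) m = ∑ i, m i * (u n * W i) := by
            rw [wt, Finset.mul_sum]; exact Finset.sum_congr rfl fun i _ => by ring
        _ < ∑ i, m i * (u i * W n) := by
            refine Finset.sum_lt_sum (fun i _ => Nat.mul_le_mul_left _
              (seq_E1 u W T Q upos hQ hrec W0 W1 Wrec i n i.2).le) ⟨l, Finset.mem_univ _, ?_⟩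
            exact Nat.mul_lt_mul_of_pos_left (seq_E1 u W T Q upos hQ hrec W0 W1 Wrec l n l.2)
              (Nat.pos_of_ne_zero hl)
        _ = wt (fun i : Fin n => u i) m * W n := by
            rw [wt, Finset.sum_mul]; exact Finset.sum_congr rfl fun i _ => by ring
        _ = u n * W n := by rw [h]
    exact Nat.lt_of_mul_lt_mul_left h1
  have hmod := seq_canc u upos _ _ ((seq_cong_wt u W T Q hrec W0 W1 Wrec m).trans
    (h ▸ (seq_cong u W T Q hrec W0 W1 Wrec n).symm))
  have h1 := Nat.le_of_dvd (by omega) ((Nat.modEq_iff_dvd' hlt.le).mp hmod)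
  omega

end seqs

section wseq
variable {p q : ℕ}

def Wseq (p q d k : ℕ) : ℕ := pqFib p q (k * d) / pqFib p q d

lemma F_dvd (hp : 0 < p) (d k : ℕ) : pqFib p q d ∣ pqFib p q (k * d) := by
  induction k using Nat.twoStepInduction with
  | zero => simp [pqFib]
  | one => simp
  | more k h1 h2 =>
    have h := F_id (q := q) hp (k * d) d
    rw [show k * d + 2 * d = (k + 2) * d by ring, show k * d + d = (k + 1) * d by ring] at h
    zify at h1 h2 ⊢
    rw [eq_sub_of_add_eq h]
    exact dvd_sub (Dvd.dvd.mul_left h2 _) (Dvd.dvd.mul_left h1 _)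

lemma W_spec (hp : 0 < p) (d k : ℕ) : Wseq p q d k * pqFib p q d = pqFib p q (k * d) :=
  Nat.div_mul_cancel (F_dvd hp d k)

lemma F_pos' (hp : 0 < p) {d : ℕ} (hd : 0 < d) : 0 < pqFib p q d := by
  obtain ⟨e, rfl⟩ : ∃ e, d = e + 1 := ⟨d - 1, by omega⟩
  exact F_pos hp e

lemma W_rec (hp : 0 < p) (d : ℕ) (hd : 0 < d) (hde : Even d) (k : ℕ) :
    Wseq p q d (k + 2) + q ^ d * Wseq p q d k = pqLucas p q d * Wseq p q d (k + 1) := by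
  have h := F_id (q := q) hp (k * d) d
  rw [hde.neg_pow, show k * d + 2 * d = (k + 2) * d by ring,
    show k * d + d = (k + 1) * d by ring, ← W_spec hp, ← W_spec hp, ← W_spec hp] at h
  have h' : Wseq p q d (k + 2) * pqFib p q d + q ^ d * (Wseq p q d k * pqFib p q d)
    = pqLucas p q d * (Wseq p q d (k + 1) * pqFib p q d) := by exact_mod_cast h
  apply Nat.eq_of_mul_eq_mul_right (F_pos' (q := q) hp hd)
  linarith

lemma W_zero (d : ℕ) : Wseq p q d 0 = 0 := by simp [Wseq, pqFib]

lemma W_one (hp : 0 < p) (d : ℕ) (hd : 0 < d) : Wseq p q d 1 = 1 := by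
  simp [Wseq, Nat.div_self (F_pos' (q := q) hp hd)]

lemma F_mono' (hp : 0 < p) {m n : ℕ} (h : m ≤ n) : pqFib p q m ≤ pqFib p q n :=
  monotone_nat_of_le_succ (f := pqFib p q) (F_mono hp) h

lemma W_strict (hp : 0 < p) (hq : 0 < q) (d : ℕ) (hd : 2 ≤ d) : StrictMono (Wseq p q d) := by
  apply strictMono_nat_of_lt_succ
  intro k
  apply Nat.lt_of_mul_lt_mul_right (a := pqFib p q d)
  rw [W_spec hp, W_spec hp]
  have h1 : pqFib p q (k * d + 2) ≤ pqFib p q ((k + 1) * d) := F_mono' hp (by nlinarith)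
  refine lt_of_lt_of_le ?_ h1
  rw [F_rec]
  have h2 := F_pos (q := q) hp (k * d)
  have h3 := F_mono (q := q) hp (k * d)
  rcases Nat.eq_zero_or_pos (pqFib p q (k * d)) with h4 | h4
  · rw [h4]; have := Nat.mul_pos hp h2; omega
  · have := Nat.mul_pos hq h4
    have := Nat.le_mul_of_pos_left (pqFib p q (k * d + 1)) hp
    omega

lemma W_E2 (hp : 0 < p) (d : ℕ) (hd : 0 < d) (k m : ℕ) (hm : 1 ≤ m) :
    Wseq p q d k * pqLucas p q m ≤ pqLucas p q (m + k * d) := by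
  refine le_trans (Nat.mul_le_mul_right _ ?_) (L_ge_F hp m (k * d) hm)
  rw [← W_spec hp]
  exact Nat.le_mul_of_pos_right _ (F_pos' hp hd)

lemma U_rec (hp : 0 < p) (a d : ℕ) (hde : Even d) (j : ℕ) :
    pqLucas p q (a + (j + 2) * d) + q ^ d * pqLucas p q (a + j * d)
      = pqLucas p q d * pqLucas p q (a + (j + 1) * d) := by
  have := L_even (q := q) hp (a + j * d) d hde
  rw [show a + j * d + 2 * d = a + (j + 2) * d by ring,
    show a + j * d + d = a + (j + 1) * d by ring] at this
  exact this

lemma W_three (hp : 0 < p) (d : ℕ) (hd : 0 < d) (hde : Even d) :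
    Wseq p q d 3 = pqLucas p q (2 * d) + q ^ d ∧ 2 * q ^ d < pqLucas p q (2 * d) := by
  have e1 := W_rec (q := q) hp d hd hde 0
  have e2 := W_rec (q := q) hp d hd hde 1
  simp only [W_zero, W_one hp d hd, zero_add, mul_zero, add_zero, mul_one, Nat.reduceAdd] at e1 e2
  have e3 := L_even (q := q) hp 0 d hde
  have e4 := L_q (q := q) hp 0 d hd
  simp only [zero_add] at e3 e4
  have : pqLucas p q 0 = 2 := rfl
  rw [this] at e3 e4
  rw [e1] at e2
  constructor <;> omega

lemma W_two_eq (hp : 0 < p) (d : ℕ) (hd : 0 < d) (hde : Even d) :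
    Wseq p q d 2 = pqLucas p q d := by
  have e1 := W_rec (q := q) hp d hd hde 0
  simpa only [W_zero, W_one hp d hd, zero_add, mul_zero, add_zero, mul_one, Nat.reduceAdd] using e1

end wseq

section arith
variable {p q : ℕ}

/-- failure of condition (c), in explicit form. -/
def NotC (a d : ℕ) : Prop :=
  ¬ ∃ g m, 0 < g ∧ 0 < m ∧ Even g ∧ Even m ∧ a = g * (m + 1) ∧ d = g * m

lemma prod_lt (hp : 0 < p) {m n : ℕ} (hm : 0 < m) (hn : 0 < n) :
    pqLucas p q m * pqLucas p q n < 2 * pqLucas p q (m + n) := by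
  rcases L_le_prod (q := q) hp m n with h | h | h
  · exact h
  · omega
  · omega

lemma K1p (hp : 0 < p) (hq : 0 < q) (a d g m e : ℕ) (hd : 0 < d) (hg : 0 < g)
    (ha : a = g * m) (hde : d = g * e) (he : Even e) (hm : Odd m) (hem : e < m)
    (hc : NotC a d) : pqLucas p q d * pqLucas p q g < pqLucas p q a := by
  have he0 : 0 < e := Nat.pos_of_ne_zero (by rintro rfl; simp at hde; omega)
  rcases Nat.lt_or_ge (e + 1) m with h | h
  · have h1 : d + 2 * g ≤ a := by rw [ha, hde]; nlinarith
    rcases Nat.lt_or_ge g 2 with h2 | h2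
    · have : g = 1 := by omega
      subst this
      have e1 : pqLucas p q 1 = p := rfl
      rw [e1]
      have e2 : pqLucas p q (d + 1) ≤ pqLucas p q a := L_mono hp hq (by omega) (by omega)
      obtain ⟨f, rfl⟩ : ∃ f, d = f + 1 := ⟨d - 1, by omega⟩
      rw [show f + 1 + 1 = f + 2 from rfl, L_rec] at e2
      have := Nat.mul_pos hq (L_pos (q := q) hp f)
      rw [mul_comm]; omega
    · have h3 := prod_lt (q := q) hp hd hg
      have h4 : 2 * pqLucas p q (d + g) < pqLucas p q a := L_two' hp hq (by omega) (by omega)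
      omega
  · have hme : m = e + 1 := by omega
    subst hme
    have hgo : Odd g := by
      by_contra hcon
      exact hc ⟨g, e, hg, he0, Nat.not_odd_iff_even.mp hcon, he, ha, hde⟩
    have hgd : g ≤ d := by rw [hde]; exact Nat.le_mul_of_pos_right _ he0
    have h1 := L_odd (q := q) hp (d - g) g hgo
    rw [show d - g + 2 * g = d + g by omega, show d - g + g = d by omega] at h1
    rw [show a = d + g by rw [ha, hde]; ring, h1, mul_comm]
    have := Nat.mul_pos (Nat.pow_pos (n := g) hq) (L_pos (q := q) hp (d - g))
    omega

lemma K1 (hp : 0 < p) (hq : 0 < q) (hpq : Nat.gcd p q = 1) (a d : ℕ) (hd : 0 < d) (hde : Even d)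
    (had : d < a) (hc : NotC a d) :
    pqLucas p q d * Nat.gcd (pqLucas p q a) (pqLucas p q (a + d)) < pqLucas p q a := by
  obtain ⟨g, m', n', hg, hg1, e1, e2, -, h⟩ := gcdL hp hpq
    (Nat.gcd (pqLucas p q a) (pqLucas p q (a + d))) a (a + d) (by omega)
    (Nat.gcd_dvd_left _ _) (Nat.gcd_dvd_right _ _)
  set G := Nat.gcd (pqLucas p q a) (pqLucas p q (a + d))
  have hmn : m' < n' := by
    by_contra hcon
    have := Nat.mul_le_mul_left g (not_lt.mp hcon); omega
  rcases h with ⟨h1, h2, h3⟩ | ⟨h1, h2⟩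
  · have hdd : d = g * (n' - m') := by rw [Nat.mul_sub]; omega
    refine lt_of_le_of_lt (Nat.mul_le_mul_left _ (Nat.le_of_dvd (L_pos hp _) h3)) ?_
    refine K1p hp hq a d g m' (n' - m') hd hg1 e1 hdd (Nat.Odd.sub_odd h2 h1) h1 ?_ hc
    rw [e1, hdd] at had
    exact Nat.lt_of_mul_lt_mul_left had
  · have hG := Nat.le_of_dvd (by norm_num) h2
    rcases Nat.lt_or_ge a (d + 2) with h3 | h3
    · exfalso
      have ha : a = d + 1 := by omega
      apply h1
      have o1 : Odd (g * m') := by rw [← e1, ha]; exact hde.add_one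
      have o2 : Odd (g * n') := by rw [← e2, ha]; exact (hde.add_one).add_even hde
      exact ⟨(Nat.odd_mul.mp o1).2, (Nat.odd_mul.mp o2).2⟩
    · have := L_two' (q := q) hp hq hd h3
      nlinarith [Nat.mul_le_mul_left (pqLucas p q d) hG]

/-- the middle claim -/
lemma CLmid (hp : 0 < p) (hq : 0 < q) (hpq : Nat.gcd p q = 1) (a d : ℕ) (hd : 0 < d) (hde : Even d)
    (had : d < a) (hc : NotC a d) (n : ℕ)
    (nd : ∀ i j, i < j → j < n → ¬ pqLucas p q (a + i * d) ∣ pqLucas p q (a + j * d))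
    (hW : Wseq p q d (n - 2) < pqLucas p q a)
    (i j c b : ℕ) (hi : 1 ≤ i) (hi2 : i + 2 ≤ n) (hj : j < n) (hji : j ≠ i) (hc0 : 0 < c)
    (h : c * pqLucas p q (a + i * d) = b * pqLucas p q (a + j * d)) : pqLucas p q d ≤ c := by
  by_contra hcT
  have hd2 : 2 ≤ d := by obtain ⟨x, hx⟩ := hde; omega
  set T := pqLucas p q d with hT
  set ui := pqLucas p q (a + i * d) with hui
  set uj := pqLucas p q (a + j * d) with huj
  set h' := Nat.gcd ui uj with hh
  have hpos : 0 < h' := Nat.gcd_pos_of_pos_left _ (L_pos hp _)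
  have h1 : uj ∣ c * h' := by
    rw [hh, ← Nat.gcd_mul_left]
    exact Nat.dvd_gcd (h ▸ Dvd.intro_left _ rfl) (Dvd.intro_left _ rfl)
  have h2 : uj ≤ c * h' := Nat.le_of_dvd (Nat.mul_pos hc0 hpos) h1
  have h3 : uj < T * h' := by nlinarith
  rcases Nat.lt_or_gt_of_ne hji with hlt | hlt
  · -- j < i
    obtain ⟨g, m', k', hg, hg1, e1, e2, -, hcase⟩ := gcdL hp hpq h' (a + j * d) (a + i * d) (by omega)
      (Nat.gcd_dvd_right _ _) (Nat.gcd_dvd_left _ _)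
    rcases hcase with ⟨o1, o2, h4⟩ | ⟨o, h4⟩
    · have h5 : uj < T * pqLucas p q g :=
        h3.trans_le (Nat.mul_le_mul_left _ (Nat.le_of_dvd (L_pos hp _) h4))
      have hm3 : 3 ≤ m' := by
        by_contra hcon
        have : m' = 1 := by obtain ⟨x, hx⟩ := o1; omega
        rw [this, mul_one] at e1
        apply nd j i hlt (by omega)
        rw [e1, e2]
        exact L_dvd hp g k' o2
      have h6 := prod_lt (q := q) hp hd hg1
      rw [← hT] at h6
      have h7 : a + j * d ≤ d + g + 1 := by
        by_contra hcon
        have : 2 * pqLucas p q (d + g) < uj := L_two' hp hq (by omega) (by omega)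
        omega
      have h8 : g * 3 ≤ a + j * d := by rw [e1]; exact Nat.mul_le_mul_left _ hm3
      rcases Nat.eq_zero_or_pos j with rfl | hj0
      · have h5a : pqLucas p q (a + 0 * d) < _ := h5
        simp only [zero_mul, add_zero] at e1 h5a h7 h8
        have hmk : m' < k' := by
          by_contra hcon
          have := Nat.mul_le_mul_left g (not_lt.mp hcon)
          have : 0 < i * d := Nat.mul_pos hi hd
          omega
        have hid : i * d = g * (k' - m') := by rw [Nat.mul_sub]; omega
        obtain ⟨s, hs⟩ := Nat.Odd.sub_odd o2 o1
        rcases Nat.lt_or_ge i 3 with hi3 | hi3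
        · obtain rfl | rfl : i = 1 ∨ i = 2 := by omega
          · rw [one_mul] at hid
            have := K1p (q := q) hp hq a d g m' (k' - m') hd hg1 e1 hid ⟨s, hs⟩ o1 (by
              rw [e1, hid] at had
              exact Nat.lt_of_mul_lt_mul_left had) hc
            exact absurd h5a this.not_gt
          · have hds : d = g * s := by
              rw [hs] at hid
              have : 2 * d = 2 * (g * s) := by rw [hid]; ring
              omega
            have hsm : s < m' := by
              rw [e1, hds] at had
              exact Nat.lt_of_mul_lt_mul_left had
            rcases Nat.even_or_odd s with hse | hso
            · have := K1p (q := q) hp hq a d g m' s hd hg1 e1 hds hse o1 hsm hc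
              exact absurd h5a this.not_gt
            · have hge : Even g := by
                rw [hds] at hde
                exact (Nat.even_mul.mp hde).resolve_right (Nat.not_even_iff_odd.mpr hso)
              have hsm2 : s + 2 ≤ m' := by
                obtain ⟨x, hx⟩ := hso; obtain ⟨y, hy⟩ := o1; omega
              have : g * (s + 2) ≤ a := by rw [e1]; exact Nat.mul_le_mul_left _ hsm2
              have h9 : g * (s + 2) = d + 2 * g := by rw [hds]; ring
              obtain ⟨x, hx⟩ := hge
              omega
        · have h9 : a ≤ 2 * d := by obtain ⟨x, hx⟩ := hde; omega
          have h10 : pqLucas p q a ≤ pqLucas p q (2 * d) := L_mono hp hq (by omega) h9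
          have h11 := (W_three (q := q) hp d hd hde).1
          have h12 : Wseq p q d 3 ≤ Wseq p q d (n - 2) :=
            (W_strict hp hq d hd2).monotone (by omega)
          omega
      · have : d ≤ j * d := Nat.le_mul_of_pos_left _ hj0
        omega
    · have hG := Nat.le_of_dvd (by norm_num) h4
      rcases Nat.lt_or_ge (a + j * d) (d + 2) with h5 | h5
      · have ha : a + j * d = d + 1 := by omega
        apply o
        have o1 : Odd (g * m') := by rw [← e1, ha]; exact hde.add_one
        have o2 : Odd (g * k') := by
          rw [← e2]
          have : a + i * d = d + 1 + (i - j) * d := by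
            rw [← ha, Nat.sub_mul]
            have := Nat.mul_le_mul_right d hlt.le
            omega
          rw [this]
          exact (hde.add_one).add_even (hde.mul_left _)
        exact ⟨(Nat.odd_mul.mp o1).2, (Nat.odd_mul.mp o2).2⟩
      · have := L_two' (q := q) hp hq hd h5
        nlinarith [Nat.mul_le_mul_left T hG]
  · -- i < j
    have h4 : 2 * h' ≤ ui := by
      obtain ⟨x, hx⟩ := Nat.gcd_dvd_left ui uj
      rw [← hh] at hx
      have hx2 : 2 ≤ x := by
        by_contra hcon
        have hupos : 0 < ui := L_pos hp _
        have : x = 1 := by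
          have : x ≠ 0 := by rintro rfl; omega
          omega
        apply nd i j hlt hj
        rw [← hui, ← huj, hx, this, mul_one]
        exact Nat.gcd_dvd_right _ _
      rw [hx, mul_comm]; exact Nat.mul_le_mul_left _ hx2
    have h5 : T * (2 * h') ≤ T * ui := Nat.mul_le_mul_left _ h4
    have e := U_rec (q := q) hp a d hde (i - 1)
    rw [show i - 1 + 2 = i + 1 by omega, show i - 1 + 1 = i by omega] at e
    have e' := L_q (q := q) hp (a + (i - 1) * d) d hd
    rw [show a + (i - 1) * d + 2 * d = a + (i - 1 + 2) * d by ring,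
      show i - 1 + 2 = i + 1 by omega] at e'
    have e'' : pqLucas p q (a + (i + 1) * d) ≤ uj :=
      L_mono hp hq (by omega) (Nat.add_le_add_left (Nat.mul_le_mul_right _ hlt) _)
    rw [← hT, ← hui] at e
    nlinarith

end arith

section fin
variable {p q : ℕ}

lemma aux_pq (p q : ℕ) (hq : 0 < q) : ¬ (p * p + q * 2 < 2 * p) := by
  intro h
  rcases Nat.lt_or_ge p 2 with h2 | h2
  · interval_cases p <;> omega
  · have := Nat.mul_le_mul_right p h2
    omega

set_option maxHeartbeats 1000000 in
lemma case_two (hp : 0 < p) (hq : 0 < q) (hpq : Nat.gcd p q = 1) (a d : ℕ) (hd : 0 < d)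
    (hde : Even d) (had : d < a) (n : ℕ) (hn : 3 ≤ n)
    (nd : ¬ pqLucas p q a ∣ pqLucas p q (a + (n - 1) * d))
    (h3 : n = 3 → ∀ m, Odd m → a = d * m → ¬ Odd (pqLucas p q d))
    (G D1 : ℕ) (hG : G = Nat.gcd (pqLucas p q a) (pqLucas p q (a + d)))
    (hD1 : pqLucas p q a = D1 * G)
    (c b : ℕ) (hc0 : 0 < c) (h : c * pqLucas p q a = b * pqLucas p q (a + (n - 1) * d))
    (hle : c * pqLucas p q a ≤ D1 * pqLucas p q (a + d)) :
    4 ≤ n ∧ Wseq p q d 3 * pqLucas p q (a + d) < D1 * pqLucas p q a := by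
  have hd2 : 2 ≤ d := by obtain ⟨x, hx⟩ := hde; omega
  have hu0pos : 0 < pqLucas p q a := L_pos hp _
  have hu1pos : 0 < pqLucas p q (a + d) := L_pos hp _
  have hTpos : 0 < pqLucas p q d := L_pos hp _
  have hGpos : 0 < G := by rw [hG]; exact Nat.gcd_pos_of_pos_left _ hu0pos
  have hD1pos : 0 < D1 := Nat.pos_of_ne_zero (by rintro rfl; simp at hD1; omega)
  set u0 := pqLucas p q a with hu0
  set u1 := pqLucas p q (a + d) with hu1
  set ut := pqLucas p q (a + (n - 1) * d) with hut
  set T := pqLucas p q d with hT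
  set G' := Nat.gcd u0 ut with hG'
  have hG'pos : 0 < G' := Nat.gcd_pos_of_pos_left _ hu0pos
  have hcG : c * G ≤ u1 := by
    have : D1 * (c * G) ≤ D1 * u1 := by
      calc D1 * (c * G) = c * (D1 * G) := by ring
        _ = c * u0 := by rw [hD1]
        _ ≤ _ := hle
    exact Nat.le_of_mul_le_mul_left this hD1pos
  have h1 : ut ∣ c * G' := by
    rw [hG', ← Nat.gcd_mul_left]
    exact Nat.dvd_gcd (h ▸ Dvd.intro_left _ rfl) (Dvd.intro_left _ rfl)
  have h2 : ut ≤ c * G' := Nat.le_of_dvd (Nat.mul_pos hc0 hG'pos) h1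
  have hmain : G * ut ≤ u1 * G' := by
    calc G * ut ≤ G * (c * G') := Nat.mul_le_mul_left _ h2
      _ = (c * G) * G' := by ring
      _ ≤ _ := Nat.mul_le_mul_right _ hcG
  have hut_le : ∀ j, j + 1 ≤ n → pqLucas p q (a + j * d) ≤ ut := fun j hj =>
    L_mono hp hq (by omega) (Nat.add_le_add_left (Nat.mul_le_mul_right _ (by omega)) _)
  have hG'2 : 2 < G' := by
    by_contra hcon
    have e1 : 2 * u1 < pqLucas p q (a + 2 * d) := L_two' hp hq (by omega) (by omega)
    have e2 := hut_le 2 (by omega)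
    have e3 : ut ≤ G * ut := Nat.le_mul_of_pos_left _ hGpos
    have e4 : u1 * G' ≤ u1 * 2 := Nat.mul_le_mul_left _ (by omega)
    omega
  obtain ⟨g, m', k', hg, hg1, e1, e2, -, hcase⟩ := gcdL hp hpq G' a (a + (n - 1) * d) (by omega)
      (Nat.gcd_dvd_left _ _) (Nat.gcd_dvd_right _ _)
  rcases hcase with ⟨o1, o2, h4⟩ | ⟨-, h4⟩
  swap
  · have := Nat.le_of_dvd (by norm_num) h4; omega
  have hm3 : 3 ≤ m' := by
    by_contra hcon
    have : m' = 1 := by obtain ⟨x, hx⟩ := o1; omega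
    rw [this, mul_one] at e1
    apply nd
    rw [hu0, hut, e2, e1]
    exact L_dvd hp g k' o2
  have hG'g : G' ≤ pqLucas p q g := Nat.le_of_dvd (L_pos hp _) h4
  have hmain' : G * ut ≤ u1 * pqLucas p q g := hmain.trans (Nat.mul_le_mul_left _ hG'g)
  rcases Nat.lt_or_ge n 4 with hn4 | hn4
  · exfalso
    have hn3 : n = 3 := by omega
    subst hn3
    simp only [Nat.reduceSub] at hut e2
    have hmk : m' < k' := by
      by_contra hcon
      have := Nat.mul_le_mul_left g (not_lt.mp hcon)
      omega
    have hid : 2 * d = g * (k' - m') := by rw [Nat.mul_sub]; omega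
    obtain ⟨s, hs⟩ := Nat.Odd.sub_odd o2 o1
    have hds : d = g * s := by
      rw [hs] at hid
      have : 2 * d = 2 * (g * s) := by rw [hid]; ring
      omega
    have f1 : ut + q ^ d * u0 = T * u1 := by
      have := U_rec (q := q) hp a d hde 0
      simpa using this
    have f2 : q ^ d * u0 < ut := L_q (q := q) hp a d hd
    have f3 : ut ≤ G * ut := Nat.le_mul_of_pos_left _ hGpos
    have f4 : T < 2 * pqLucas p q g := by
      have : u1 * T < u1 * (2 * pqLucas p q g) := by nlinarith
      exact Nat.lt_of_mul_lt_mul_left this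
    have hs1 : s = 1 := by
      by_contra hs1
      have hs2 : 2 ≤ s := by
        have : s ≠ 0 := by rintro rfl; simp at hds; omega
        omega
      have : g * 2 ≤ d := by rw [hds]; exact Nat.mul_le_mul_left _ hs2
      rcases Nat.lt_or_ge d (g + 2) with h5 | h5
      · have hg' : g = 1 := by omega
        have hd' : d = 2 := by omega
        rw [hT, hg', hd'] at f4
        have e1 : pqLucas p q 1 = p := rfl
        have e2 : pqLucas p q 2 = p * p + q * 2 := rfl
        rw [e1, e2] at f4
        exact aux_pq p q hq f4
      · have := L_two' (q := q) hp hq hg1 h5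
        omega
    rw [hs1, mul_one] at hds
    rw [← hds, ← hT] at hmain'
    have hG1 : G = 1 := by
      have : G * ut < 2 * ut := by nlinarith
      have := Nat.lt_of_mul_lt_mul_right this
      omega
    rw [← hds] at e1
    apply h3 rfl m' o1 e1
    by_contra hTe
    rw [Nat.not_odd_iff_even] at hTe
    have g1 : 2 ∣ u0 := by
      rw [hu0, e1]
      exact (even_iff_two_dvd.mp hTe).trans (L_dvd hp d m' o1)
    have g2 : 2 ∣ u1 := by
      rw [← even_iff_two_dvd]
      rcases Nat.even_or_odd p with hpe | hpo
      · exact L_parity3 hpe _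
      · rcases Nat.even_or_odd q with hqe | hqo
        · exact absurd (L_parity1 hpo hqe d hd) (Nat.not_odd_iff_even.mpr hTe)
        · rw [hT, L_parity2 hpo hqo] at hTe
          rw [hu1, L_parity2 hpo hqo, e1]
          exact dvd_add (Dvd.dvd.mul_right hTe _) hTe
    have := Nat.dvd_gcd g1 g2
    rw [← hG, hG1] at this
    omega
  · refine ⟨hn4, ?_⟩
    have f1 := L_even (q := q) hp (a - d) (2 * d) (hde.mul_left _)
    have f2 := L_q (q := q) hp (a - d) (2 * d) (by omega)
    rw [show a - d + 2 * (2 * d) = a + 3 * d by omega] at f1 f2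
    rw [show a - d + 2 * d = a + d by omega, ← hu1] at f1
    have f3 := hut_le 3 (by omega)
    have f4 : G * pqLucas p q (2 * d) < 2 * pqLucas p q g := by
      have : u1 * (G * pqLucas p q (2 * d)) < u1 * (2 * pqLucas p q g) := by
        have i1 : pqLucas p q (2 * d) * u1 < 2 * pqLucas p q (a + 3 * d) := by omega
        have i2 : G * (pqLucas p q (2 * d) * u1) < G * (2 * pqLucas p q (a + 3 * d)) :=
          Nat.mul_lt_mul_of_pos_left i1 hGpos
        have i3 := Nat.mul_le_mul_left G f3
        nlinarith
      exact Nat.lt_of_mul_lt_mul_left this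
    have hgd : 2 * d ≤ g + 1 := by
      by_contra hcon
      have j1 := L_two' (q := q) hp hq hg1 (show g + 2 ≤ 2 * d by omega)
      have j2 := Nat.le_mul_of_pos_left (pqLucas p q (2 * d)) hGpos
      omega
    have f5 := W_three (q := q) hp d hd hde
    have f6 : u1 < T * u0 := by
      have := L_even (q := q) hp (a - d) d hde
      rw [show a - d + 2 * d = a + d by omega, show a - d + d = a by omega, ← hT, ← hu0, ← hu1] at this
      have h' := Nat.mul_pos (Nat.pow_pos (n := d) hq) (L_pos (q := q) hp (a - d))
      omega
    have f7 : 4 * (T * pqLucas p q g) ≤ u0 := by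
      have j0 : pqLucas p q (3 * g) ≤ u0 :=
        L_mono hp hq (by omega) (by rw [e1, mul_comm 3]; exact Nat.mul_le_mul_left _ hm3)
      have j1 : 2 * T < pqLucas p q (d + 2) := L_two hp hq hd
      have j2 : 2 * pqLucas p q (d + 2) < pqLucas p q (d + 4) := L_two' hp hq (by omega) (by omega)
      rcases Nat.even_or_odd g with hge | hgo
      · have j3 : 2 * pqLucas p q (d + 4) < pqLucas p q (2 * g) :=
          L_two' hp hq (by omega) (by obtain ⟨x, hx⟩ := hge; omega)
        have j4 := prod_lt (q := q) hp hg1 (show 0 < 2 * g by omega)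
        rw [show g + 2 * g = 3 * g by ring] at j4
        have j5 : pqLucas p q g * (8 * T) ≤ pqLucas p q g * pqLucas p q (2 * g) :=
          Nat.mul_le_mul_left _ (by omega)
        linarith
      · have j3 : pqLucas p q (d + 4) ≤ pqLucas p q (2 * g) :=
          L_mono hp hq (by omega) (by omega)
        have j4 := L_odd (q := q) hp g g hgo
        rw [show g + 2 * g = 3 * g by ring, show g + g = 2 * g by ring] at j4
        have j6 := Nat.zero_le (q ^ g * pqLucas p q g)
        have j5 : pqLucas p q g * (4 * T) ≤ pqLucas p q g * pqLucas p q (2 * g) :=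
          Nat.mul_le_mul_left _ (by omega)
        linarith
    have key : G * (Wseq p q d 3 * u1) < G * (D1 * u0) := by
      have k1 : G * Wseq p q d 3 ≤ 4 * pqLucas p q g := by
        have : G * Wseq p q d 3 ≤ G * (2 * pqLucas p q (2 * d)) := Nat.mul_le_mul_left _ (by omega)
        linarith
      calc G * (Wseq p q d 3 * u1) = G * Wseq p q d 3 * u1 := by ring
        _ ≤ 4 * pqLucas p q g * u1 := Nat.mul_le_mul_right _ k1
        _ < 4 * pqLucas p q g * (T * u0) :=
          Nat.mul_lt_mul_of_pos_left f6 (by have := L_pos (q := q) hp g; omega)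
        _ = 4 * (T * pqLucas p q g) * u0 := by ring
        _ ≤ u0 * u0 := Nat.mul_le_mul_right _ f7
        _ = G * (D1 * u0) := by nth_rewrite 1 [hD1]; ring
    exact Nat.lt_of_mul_lt_mul_left key

lemma NCI_main (k : Type*) [Field k] (hp : 0 < p) (hq : 0 < q) (hpq : Nat.gcd p q = 1) (a d : ℕ)
    (hd : 0 < d) (hde : Even d) (had : d < a) (hc : NotC a d) (n : ℕ) (hn : 3 ≤ n)
    (h3 : n = 3 → ∀ m, Odd m → a = d * m → ¬ Odd (pqLucas p q d)) :
    NCI k (fun i : Fin n => pqLucas p q (a + (i : ℕ) * d)) := by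
  have hd2 : 2 ≤ d := by obtain ⟨x, hx⟩ := hde; omega
  set u : ℕ → ℕ := fun j => pqLucas p q (a + j * d) with hu
  set W := Wseq p q d with hWdef
  set T := pqLucas p q d with hT
  set Q := q ^ d with hQdef
  have upos : ∀ i, 0 < u i := fun i => L_pos hp _
  have hrec : ∀ j, u (j + 2) + Q * u j = T * u (j + 1) := U_rec hp a d hde
  have W0 : W 0 = 0 := W_zero d
  have W1 : W 1 = 1 := W_one hp d hd
  have W2 : W 2 = T := W_two_eq hp d hd hde
  have Wrec : ∀ j, W (j + 2) + Q * W j = T * W (j + 1) := W_rec hp d hd hde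
  have hQ : 0 < Q := Nat.pow_pos hq
  have hTpos : 0 < T := L_pos hp _
  have Wst : StrictMono W := W_strict hp hq d hd2
  have ustrict : StrictMono u := by
    apply strictMono_nat_of_lt_succ
    intro j
    exact L_strict hp hq (by omega) (by nlinarith)
  have hu0 : u 0 = pqLucas p q a := by simp [hu]
  have hu1 : u 1 = pqLucas p q (a + d) := by simp [hu]
  have E2 : ∀ i, W i * u 0 ≤ u i := by
    intro i; rw [hu0]; exact W_E2 hp d hd i a (by omega)
  have E2' : ∀ i, W i * u 1 ≤ u (i + 1) := by
    intro i; rw [hu1]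
    have := W_E2 (q := q) hp d hd i (a + d) (by omega)
    rw [show a + d + i * d = a + (i + 1) * d by ring] at this
    exact this
  set G := Nat.gcd (u 0) (u 1) with hG
  have hGpos : 0 < G := Nat.gcd_pos_of_pos_left _ (upos 0)
  set D1 := u 0 / G with hD1
  have hD1G : u 0 = D1 * G := (Nat.div_mul_cancel (Nat.gcd_dvd_left _ _)).symm
  have hK1 : T < D1 := by
    have := K1 hp hq hpq a d hd hde had hc
    rw [← hu0, ← hu1, ← hG, ← hT, hD1G] at this
    exact Nat.lt_of_mul_lt_mul_right this
  have hD1le : D1 ≤ u 0 := Nat.div_le_self _ _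
  have hD1pos : 0 < D1 := by omega
  have hT3 : 3 ≤ T := by
    have h1 := L_mono (p := p) (q := q) hp hq (show 1 ≤ 2 by norm_num) hd2
    have e2 : pqLucas p q 2 = p * p + q * 2 := rfl
    have := Nat.mul_pos hp hp
    omega
  have hTQ : ¬ T ∣ Q := by
    intro h
    have hcop : Nat.Coprime T Q := Nat.Coprime.pow_right d (L_coprime hpq d hd)
    have := Nat.Coprime.eq_one_of_dvd hcop h
    omega
  have hred : ∀ (j : ℕ) (m : Fin j →₀ ℕ), wt (fun i : Fin j => u i) m = u j → D1 ≤ W j :=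
    fun j m h => seq_red u W T Q upos hQ hrec W0 W1 Wrec m h
  have hD : u 0 ∣ D1 * u 1 := by
    obtain ⟨D2, h2⟩ : G ∣ u 1 := Nat.gcd_dvd_right _ _
    refine ⟨D2, ?_⟩
    rw [h2, hD1G]; ring
  have wts : ∀ (j : ℕ) (i : Fin j) (c : ℕ),
      wt (fun i : Fin j => u i) (Finsupp.single i c) = c * u i := by
    intro j i c
    unfold wt
    rw [Finset.sum_eq_single i]
    · simp
    · intro b _ hb; rw [Finsupp.single_eq_of_ne (by tauto)]; simp
    · simp
  have wta : ∀ (j : ℕ) (m m' : Fin j →₀ ℕ), wt (fun i : Fin j => u i) (m + m')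
      = wt (fun i : Fin j => u i) m + wt (fun i : Fin j => u i) m' := by
    intro j m m'
    simp [wt, add_mul, Finset.sum_add_distrib]
  have core : ∀ n, 3 ≤ n → (n = 3 → ∀ m, Odd m → a = d * m → ¬ Odd T) →
      (¬ ∃ m : Fin (n - 1) →₀ ℕ, wt (fun i : Fin (n - 1) => u i) m = u (n - 1)) →
      NCI k (fun i : Fin n => u i) := by
    intro n hn h3 hNR
    have hWD : W (n - 2) < D1 := by
      by_contra hcon
      have h1 : D1 * u 1 ≤ u (n - 1) := by
        have := E2' (n - 2)
        rw [show n - 2 + 1 = n - 1 by omega] at this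
        exact (Nat.mul_le_mul_right _ (not_lt.mp hcon)).trans this
      obtain ⟨x, y, hxy⟩ := pair_frob (q := q) hp a d (n - 1) (by
        rw [← hu0, ← hu1, ← hG]
        calc u 0 * u 1 = D1 * u 1 * G := by rw [hD1G]; ring
          _ ≤ _ := Nat.mul_le_mul_right _ h1)
      rw [← hu0, ← hu1] at hxy
      apply hNR
      refine ⟨Finsupp.single ⟨0, by omega⟩ x + Finsupp.single ⟨1, by omega⟩ y, ?_⟩
      rw [wta, wts, wts]
      exact hxy.symm
    have nd : ∀ i j, i < j → j < n → ¬ u i ∣ u j := by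
      rintro i j hij hjn ⟨c, hc⟩
      have hm : wt (fun i : Fin j => u i) (Finsupp.single ⟨i, hij⟩ c) = u j := by
        rw [wts, hc, mul_comm]
      rcases Nat.lt_or_ge j (n - 1) with h | h
      · have h1 := hred j _ hm
        have h2 : W j ≤ W (n - 2) := Wst.monotone (by omega)
        omega
      · have hj : j = n - 1 := by omega
        subst hj
        exact hNR ⟨_, hm⟩
    refine comb k u W T Q D1 hn upos ustrict hTpos hQ hrec W0 W1 Wrec Wst hTQ
      (seq_E1 u W T Q upos hQ hrec W0 W1 Wrec) (seq_TL u W T Q upos hrec W0 W1 Wrec E2)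
      (CLmid hp hq hpq a d hd hde had hc n nd (by rw [← hu0]; exact hWD.trans_le hD1le))
      hD1pos hD ?_
    intro c b hc0 h hle
    have nd0 := nd 0 (n - 1) (by omega) (by omega)
    rw [hu0] at nd0 h hle hD1G ⊢
    rw [hu1] at hle ⊢
    exact case_two hp hq hpq a d hd hde had n hn nd0 h3 G D1 (by rw [hG, hu0, hu1]) hD1G c b hc0 h hle
  have hstep3 : ∀ m : Fin 3 →₀ ℕ, wt (fun i : Fin 3 => u i) m = u 3 →
      ∀ m, Odd m → a = d * m → ¬ Odd T := by
    intro w hw m hm ham hTo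
    have h1 := hred 3 w hw
    have hm3 : 3 ≤ m := by
      by_contra hcon
      have : m = 1 := by obtain ⟨x, hx⟩ := hm; omega
      rw [this] at ham; omega
    have hG2 : G ∣ 2 := by
      obtain ⟨g, m', k', hg, hg1, e1, e2, -, hcase⟩ := gcdL (q := q) hp hpq G a (a + d) (by omega)
        (by rw [← hu0]; exact Nat.gcd_dvd_left _ _) (by rw [← hu1]; exact Nat.gcd_dvd_right _ _)
      rcases hcase with ⟨o1, o2, -⟩ | ⟨-, h4⟩
      · exfalso
        have hgd : g = d := by
          rw [hg, ham]; simp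
        rw [hgd] at e2
        have : d * k' = d * (m + 1) := by rw [← e2, ham]; ring
        have := Nat.eq_of_mul_eq_mul_left hd this
        rw [this] at o2
        exact (Nat.not_odd_iff_even.mpr hm.add_one) o2
      · exact h4
    have hG1 : G = 1 := by
      rcases (Nat.dvd_prime Nat.prime_two).mp hG2 with h | h
      · exact h
      · exfalso
        have g0 : Even (u 0) := even_iff_two_dvd.mpr (h ▸ Nat.gcd_dvd_left _ _)
        have g1 : Even (u 1) := even_iff_two_dvd.mpr (h ▸ Nat.gcd_dvd_right _ _)
        rw [hu0] at g0
        rw [hu1] at g1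
        rcases Nat.even_or_odd p with hpe | hpo
        · exact (Nat.not_odd_iff_even.mpr (L_parity3 hpe d)) hTo
        · rcases Nat.even_or_odd q with hqe | hqo
          · exact (Nat.not_odd_iff_even.mpr g0) (L_parity1 hpo hqe a (by omega))
          · rw [L_parity2 hpo hqo] at g0 g1
            have h3d : 3 ∣ d := (Nat.dvd_add_right g0).mp g1
            exact (Nat.not_odd_iff_even.mpr ((L_parity2 hpo hqo d).mpr h3d)) hTo
    have f1 := W_three (q := q) hp d hd hde
    have f2 : 2 * pqLucas p q (2 * d) < pqLucas p q a := L_two' hp hq (by omega) (by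
      rw [ham]; nlinarith)
    rw [hG1, mul_one] at hD1G
    rw [hu0] at hD1G
    have f3 : W 3 = pqLucas p q (2 * d) + q ^ d := f1.1
    omega
  change NCI k (fun i : Fin n => u i)
  clear_value G D1 T Q W u
  induction n, hn using Nat.le_induction with
  | base =>
    refine core 3 le_rfl h3 ?_
    rintro ⟨m, hm⟩
    have := hred 2 m hm
    omega
  | succ n hn ih =>
    by_cases hR : ∃ m : Fin n →₀ ℕ, wt (fun i : Fin n => u i) m = u n
    · obtain ⟨m, hm⟩ := hR
      refine NCI_succ (fun i : Fin (n + 1) => u i) m (fun i => upos _) (by simpa using hm) ?_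
      refine ih ?_
      intro h
      subst h
      exact hstep3 m hm
    · exact core (n + 1) (by omega) h3 hR

end fin
/-- For relatively prime `p, q ∈ ℤ⁺`, the `(p,q)`-Lucas sequence `L`,
positive integers `a, d` and `n ≥ 3`, set `d_i = L_{a + (i−1)·d}` for
`1 ≤ i ≤ n`. Then `I_A` is a complete intersection iff (a) `d` is odd,
(b) `d ≥ a`, (c) `gcd(a,d) = a − d` and `[d]₂ > [a]₂ ≥ 1`, (d) `n = 3`, `d ∣ a`,
`a/d` and `p` are odd and `q` is even, or (e) `n = 3`, `d ∣ a`, `3 ∤ d` and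
`p, q, a/d` are all odd. -/
theorem stmt5 (k : Type*) [Field k] (p q : ℕ) (hp : 0 < p) (hq : 0 < q)
    (hpq : Nat.gcd p q = 1) (a d : ℕ) (ha : 0 < a) (hd : 0 < d)
    (n : ℕ) (hn : 3 ≤ n) :
    IsCI k (fun i : Fin n => pqLucas p q (a + (i : ℕ) * d)) ↔
      (Odd d ∨ a ≤ d ∨
        (Nat.gcd a d = a - d ∧ padicValNat 2 a < padicValNat 2 d ∧
          1 ≤ padicValNat 2 a) ∨
        (n = 3 ∧ d ∣ a ∧ Odd (a / d) ∧ Odd p ∧ Even q) ∨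
        (n = 3 ∧ d ∣ a ∧ ¬ (3 ∣ d) ∧ Odd p ∧ Odd q ∧ Odd (a / d))) := by
  constructor
  · intro hCI
    by_contra hno
    push Not at hno
    obtain ⟨n1, n2, n3, n4, n5⟩ := hno
    have hde : Even d := by simpa using n1
    have had : d < a := n2
    have hc : NotC a d := by
      intro h
      obtain ⟨h1, h2, h3⟩ := (c_iff a d hd had).mpr h
      have := n3 h1 h2
      omega
    refine not_IsCI_of_NCI _ (by omega) (NCI_main k hp hq hpq a d hd hde had hc n hn ?_) hCI
    intro hn3 m hm ham hT
    have hdvd : d ∣ a := ⟨m, ham⟩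
    have hdiv : a / d = m := by rw [ham]; exact Nat.mul_div_cancel_left _ hd
    rcases Nat.even_or_odd p with hpe | hpo
    · exact (Nat.not_odd_iff_even.mpr (L_parity3 hpe d)) hT
    · rcases Nat.even_or_odd q with hqe | hqo
      · exact n4 hn3 hdvd (hdiv ▸ hm) hpo hqe
      · have h3 : ¬ 3 ∣ d := by
          intro h
          exact (Nat.not_odd_iff_even.mpr ((L_parity2 hpo hqo d).mpr h)) hT
        have := n5 hn3 hdvd h3 hpo hqo
        rw [hdiv] at this
        exact this hm
  · exact CI_dir k p q hp hq hpq a d ha hd n hn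
end

section
/- Let A = {d_1, …, d_n} be a generalized arithmetic sequence of positive integers with n ≥ 3 and gcd(d_1, …, d_n) = 1. Then the projective toric ideal I_{A*} is a complete intersection if and only if n = 3, A is an arithmetic sequence (i.e., d_2 − d_1 = d_3 − d_2), and d_1 is even. -/
open MvPolynomial

namespace PT
open Finsupp

section general
variable {k : Type*} [Field k] {σ τ : Type*} [Fintype σ]

noncomputable def dg (w : σ → (τ →₀ ℕ)) (u : σ →₀ ℕ) : τ →₀ ℕ := ∑ i, u i • w i

noncomputable def phi (k : Type*) [Field k] (w : σ → (τ →₀ ℕ)) :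
    MvPolynomial σ k →ₐ[k] MvPolynomial τ k :=
  MvPolynomial.aeval (fun i => MvPolynomial.monomial (w i) (1 : k))

lemma phi_monomial (w : σ → (τ →₀ ℕ)) (u : σ →₀ ℕ) (c : k) :
    phi k w (MvPolynomial.monomial u c) = MvPolynomial.monomial (dg w u) c := by
  rw [phi, MvPolynomial.aeval_monomial, Finsupp.prod_fintype _ _ (by simp)]
  simp only [MvPolynomial.monomial_pow, one_pow]
  rw [← MvPolynomial.monomial_sum_one, MvPolynomial.algebraMap_eq, MvPolynomial.C_mul_monomial,
    mul_one, dg]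

def Uniq (w : σ → (τ →₀ ℕ)) (u : σ →₀ ℕ) : Prop := ∀ v, dg w v = dg w u → v = u

lemma dg_add (w : σ → (τ →₀ ℕ)) (u v : σ →₀ ℕ) : dg w (u + v) = dg w u + dg w v := by
  simp [dg, add_smul, Finset.sum_add_distrib]

lemma coeff_zero_of_uniq (w : σ → (τ →₀ ℕ)) {u : σ →₀ ℕ} (hu : Uniq w u)
    {f : MvPolynomial σ k} (hf : phi k w f = 0) : MvPolynomial.coeff u f = 0 := by
  classical
  have h := congrArg (MvPolynomial.coeff (dg w u)) hf
  rw [f.as_sum, map_sum, MvPolynomial.coeff_sum] at h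
  simp only [phi_monomial, MvPolynomial.coeff_monomial, MvPolynomial.coeff_zero] at h
  rw [Finset.sum_eq_single u] at h
  · simpa using h
  · intro v _ hv
    rw [if_neg]
    intro h'; exact hv (hu v h')
  · intro h'
    simpa using h'

lemma coeff_mul_iso (w : σ → (τ →₀ ℕ)) {u : σ →₀ ℕ} (hu : ∀ q, q < u → Uniq w q)
    {f : MvPolynomial σ k} (hf : phi k w f = 0) (g : MvPolynomial σ k) :
    MvPolynomial.coeff u (g * f) = MvPolynomial.coeff 0 g * MvPolynomial.coeff u f := by
  classical
  rw [MvPolynomial.coeff_mul, Finset.sum_eq_single (0, u)]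
  · rintro ⟨p, q⟩ hpq hne
    rw [Finset.HasAntidiagonal.mem_antidiagonal] at hpq
    dsimp only at hpq
    have hq : q < u := by
      refine lt_of_le_of_ne (hpq ▸ le_add_self) ?_
      rintro rfl
      apply hne
      simpa using hpq
    rw [coeff_zero_of_uniq w (hu q hq) hf, mul_zero]
  · intro h; simp at h

lemma main_count (w : σ → (τ →₀ ℕ)) (m : ℕ) (g : Fin m → MvPolynomial σ k)
    (hg : Ideal.span (Set.range g) = RingHom.ker (phi k w).toRingHom)
    (U : Fin (m+1) → (σ →₀ ℕ)) (hU : ∀ i, ¬ Uniq w (U i))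
    (hU' : ∀ i q, q < U i → Uniq w q)
    (hd : ∀ i j, i ≠ j → dg w (U i) ≠ dg w (U j)) : False := by
  classical
  have hU2 : ∀ i, ∃ v, dg w v = dg w (U i) ∧ v ≠ U i := by
    intro i; have := hU i; unfold Uniq at this; push Not at this; exact this
  choose V hV hVU using hU2
  have hgk : ∀ l, phi k w (g l) = 0 := by
    intro l
    have : g l ∈ RingHom.ker (phi k w).toRingHom := hg ▸ Ideal.subset_span ⟨l, rfl⟩
    simpa [RingHom.mem_ker] using this
  have hF : ∀ i, ∃ c : Fin m → MvPolynomial σ k, ∑ l, c l * g l =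
      MvPolynomial.monomial (U i) 1 - MvPolynomial.monomial (V i) 1 := by
    intro i
    have : MvPolynomial.monomial (U i) 1 - MvPolynomial.monomial (V i) 1 ∈
        Ideal.span (Set.range g) := by
      rw [hg, RingHom.mem_ker]
      show phi k w _ = 0
      rw [map_sub, phi_monomial, phi_monomial, hV, sub_self]
    exact Ideal.mem_span_range_iff_exists_fun.mp this
  choose c hc using hF
  let A : Matrix (Fin (m+1)) (Fin m) k := fun i l => MvPolynomial.coeff 0 (c i l)
  let B : Matrix (Fin m) (Fin (m+1)) k := fun l j => MvPolynomial.coeff (U j) (g l)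
  have hAB : A * B = 1 := by
    ext i j
    rw [Matrix.mul_apply, Matrix.one_apply]
    have h1 : ∑ l, A i l * B l j = MvPolynomial.coeff (U j) (∑ l, c i l * g l) := by
      rw [MvPolynomial.coeff_sum]
      exact Finset.sum_congr rfl fun l _ => (coeff_mul_iso w (hU' j) (hgk l) (c i l)).symm
    rw [h1, hc, MvPolynomial.coeff_sub, MvPolynomial.coeff_monomial, MvPolynomial.coeff_monomial]
    have h2 : V i ≠ U j := by
      intro h
      by_cases hij : i = j
      · subst hij; exact hVU i h
      · apply hd i j hij; rw [← h, hV]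
    rw [if_neg h2, sub_zero]
    by_cases hij : i = j
    · subst hij; simp
    · rw [if_neg hij, if_neg]
      intro h; exact hd i j hij (by rw [h])
  have h1 := Matrix.rank_mul_le_left A B
  rw [hAB, Matrix.rank_one] at h1
  have h2 := A.rank_le_width
  simp at h1
  omega

lemma exists_min (w : σ → (τ →₀ ℕ)) (u : σ →₀ ℕ) (hu : ¬ Uniq w u) :
    ∃ v ≤ u, ¬ Uniq w v ∧ ∀ q, q < v → Uniq w q := by
  induction u using WellFoundedLT.induction with
  | ind u ih =>
    by_cases h : ∀ q, q < u → Uniq w q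
    · exact ⟨u, le_rfl, hu, h⟩
    · push Not at h
      obtain ⟨q, hq, hq'⟩ := h
      obtain ⟨v, hv, h2⟩ := ih q hq hq'
      exact ⟨v, hv.trans hq.le, h2⟩

lemma ker_le (w : σ → (τ →₀ ℕ)) (J : Ideal (MvPolynomial σ k))
    (h : ∀ u v, dg w u = dg w v →
      Ideal.Quotient.mk J (MvPolynomial.monomial u 1) = Ideal.Quotient.mk J (MvPolynomial.monomial v 1)) :
    RingHom.ker (phi k w).toRingHom ≤ J := by
  classical
  let s : (τ →₀ ℕ) → MvPolynomial σ k ⧸ J := fun b =>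
    if hb : ∃ u, dg w u = b then Ideal.Quotient.mk J (MvPolynomial.monomial hb.choose 1) else 0
  let S : MvPolynomial τ k →ₗ[k] MvPolynomial σ k ⧸ J :=
    (MvPolynomial.basisMonomials τ k).constr k s
  have hS : S ∘ₗ (phi k w).toLinearMap = (Ideal.Quotient.mkₐ k J).toLinearMap := by
    apply (MvPolynomial.basisMonomials σ k).ext
    intro u
    simp only [MvPolynomial.coe_basisMonomials, LinearMap.comp_apply, AlgHom.toLinearMap_apply,
      phi_monomial]
    have : S (MvPolynomial.monomial (dg w u) 1) = s (dg w u) := by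
      have := (MvPolynomial.basisMonomials τ k).constr_basis k s (dg w u)
      simpa using this
    rw [this]
    have hb : ∃ v, dg w v = dg w u := ⟨u, rfl⟩
    simp only [s, dif_pos hb]
    exact h _ _ hb.choose_spec
  intro f hf
  have hf' : phi k w f = 0 := by simpa [RingHom.mem_ker] using hf
  have := LinearMap.congr_fun hS f
  simp only [LinearMap.comp_apply, AlgHom.toLinearMap_apply, hf', map_zero] at this
  rw [← Ideal.Quotient.eq_zero_iff_mem]
  exact this.symm
end general


section specific
variable {n : ℕ}

def del (d : Fin n → ℕ) (i : Fin (n+1)) : ℕ := if h : (i : ℕ) < n then d ⟨i, h⟩ else 0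

noncomputable def wt (d : Fin n → ℕ) (i : Fin (n+1)) : Fin 2 →₀ ℕ :=
  Finsupp.single 0 (del d i) + Finsupp.single 1 (Finset.univ.sup d - del d i)

lemma proj_eq (k : Type*) [Field k] (d : Fin n → ℕ) :
    projToricIdeal k d = RingHom.ker (phi k (wt d)).toRingHom := by
  unfold projToricIdeal phi
  congr 3
  funext i
  unfold wt del
  split_ifs with h
  · rw [MvPolynomial.X_pow_eq_monomial, MvPolynomial.X_pow_eq_monomial, MvPolynomial.monomial_mul,
      one_mul]
  · rw [MvPolynomial.X_pow_eq_monomial]; simp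

def TT (d : Fin n → ℕ) (u : Fin (n+1) →₀ ℕ) : ℕ := ∑ i, u i * del d i
def NN (u : Fin (n+1) →₀ ℕ) : ℕ := ∑ i, u i

lemma TT_add (d : Fin n → ℕ) (u v) : TT d (u + v) = TT d u + TT d v := by
  simp [TT, add_mul, Finset.sum_add_distrib]
lemma NN_add (u v : Fin (n+1) →₀ ℕ) : NN (u + v) = NN u + NN v := by
  simp [NN, Finset.sum_add_distrib]
lemma TT_single (d : Fin n → ℕ) (i c) : TT d (Finsupp.single i c) = c * del d i := by
  simp [TT, Finsupp.single_apply, Finset.sum_ite_eq]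
lemma NN_single (i : Fin (n+1)) (c) : NN (Finsupp.single i c) = c := by
  simp [NN, Finsupp.single_apply, Finset.sum_ite_eq]

lemma del_le (d : Fin n → ℕ) (i) : del d i ≤ Finset.univ.sup d := by
  unfold del
  split_ifs with h
  · exact Finset.le_sup (f := d) (Finset.mem_univ _)
  · exact Nat.zero_le _

lemma dg_zero (d : Fin n → ℕ) (u) : dg (wt d) u 0 = TT d u := by
  simp [dg, wt, TT, Finsupp.finsetSum_apply]
lemma dg_one (d : Fin n → ℕ) (u) : dg (wt d) u 1 + TT d u = NN u * Finset.univ.sup d := by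
  have : dg (wt d) u 1 = ∑ i, u i * (Finset.univ.sup d - del d i) := by
    simp [dg, wt, Finsupp.finsetSum_apply]
  rw [this, TT, NN, ← Finset.sum_add_distrib, Finset.sum_mul]
  refine Finset.sum_congr rfl fun i _ => ?_
  rw [← mul_add, Nat.sub_add_cancel (del_le d i)]

lemma dg_iff (d : Fin n → ℕ) (hD : 0 < Finset.univ.sup d) (u v) :
    dg (wt d) u = dg (wt d) v ↔ TT d u = TT d v ∧ NN u = NN v := by
  have h1 := dg_one d u
  have h2 := dg_one d v
  constructor
  · intro h
    have hT : TT d u = TT d v := by rw [← dg_zero, ← dg_zero, h]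
    refine ⟨hT, ?_⟩
    rw [h, hT, h2] at h1
    exact (Nat.eq_of_mul_eq_mul_right hD h1).symm
  · rintro ⟨hT, hN⟩
    ext i
    fin_cases i
    · simpa [dg_zero] using hT
    · show dg (wt d) u 1 = dg (wt d) v 1
      rw [hN] at h1; omega

lemma le_NN (u : Fin (n+1) →₀ ℕ) (i) : u i ≤ NN u :=
  Finset.single_le_sum (f := fun i => u i) (fun _ _ => Nat.zero_le _) (Finset.mem_univ i)
lemma le_TT (d : Fin n → ℕ) (u : Fin (n+1) →₀ ℕ) (i) : u i * del d i ≤ TT d u :=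
  Finset.single_le_sum (f := fun i => u i * del d i) (fun _ _ => Nat.zero_le _) (Finset.mem_univ i)

lemma NN_eq_one (u : Fin (n+1) →₀ ℕ) (h : NN u = 1) : ∃ i, u = Finsupp.single i 1 := by
  have h0 : u ≠ 0 := by rintro rfl; simp [NN] at h
  obtain ⟨i, hi⟩ := Finsupp.ne_iff.mp h0
  have hle : Finsupp.single i 1 ≤ u := by
    rw [Finsupp.single_le_iff]; simp at hi; omega
  obtain ⟨v, rfl⟩ := exists_add_of_le hle
  rw [NN_add, NN_single] at h
  refine ⟨i, ?_⟩
  have : v = 0 := by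
    ext j; have := le_NN v j; simp; omega
  rw [this, add_zero]

lemma uniq_small (d : Fin n → ℕ) (hD : 0 < Finset.univ.sup d) (hinj : Function.Injective (del d))
    (u : Fin (n+1) →₀ ℕ) (h : NN u ≤ 1) : Uniq (wt d) u := by
  intro v hv
  rw [dg_iff d hD] at hv
  obtain ⟨hT, hN⟩ := hv
  rcases Nat.le_one_iff_eq_zero_or_eq_one.mp h with h | h
  · ext j
    have := le_NN v j; have := le_NN u j; omega
  · obtain ⟨i, rfl⟩ := NN_eq_one u h
    obtain ⟨j, rfl⟩ := NN_eq_one v (by omega)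
    rw [TT_single, TT_single, one_mul, one_mul] at hT
    rw [hinj hT]

lemma le_single (u : Fin (n+1) →₀ ℕ) (j c) (h : u ≤ Finsupp.single j c) :
    ∃ c', u = Finsupp.single j c' := by
  refine ⟨u j, ?_⟩
  ext i
  have := h i
  rw [Finsupp.single_apply] at *
  split_ifs at * with hh
  · rw [hh]
  · omega

lemma le_single2 (u : Fin (n+1) →₀ ℕ) (i j : Fin (n+1)) (hij : i ≠ j) (c c') 
    (h : u ≤ Finsupp.single i c + Finsupp.single j c') :
    u i ≤ c ∧ u j ≤ c' ∧ u = Finsupp.single i (u i) + Finsupp.single j (u j) := by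
  refine ⟨?_, ?_, ?_⟩
  · have := h i; simpa [Finsupp.single_apply, hij.symm] using this
  · have := h j; simpa [Finsupp.single_apply, hij] using this
  · ext l
    have := h l
    simp only [Finsupp.add_apply, Finsupp.single_apply] at *
    by_cases h1 : i = l
    · subst h1; simp [hij.symm]
    · by_cases h2 : j = l
      · subst h2; simp [hij]
      · simp [h1, h2] at *; omega

/-- the key obstruction -/
lemma obstruct {m : ℕ} (k : Type*) [Field k] (d : Fin (m+1) → ℕ)
    (hpos : ∀ i, 0 < d i) (hmono : StrictMono d)
    (u : Fin (m+1+1) →₀ ℕ) (hu : ¬ Uniq (wt d) u) (hu' : ∀ q, q < u → Uniq (wt d) q)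
    (hdeg : ∀ j : Fin (m+1), (j : ℕ) < m → TT d u ≠ NN u * d j) : ¬ ProjIsCI k d := by
  rintro ⟨g, hg⟩
  have hsup : Finset.univ.sup d = d (Fin.last m) := by
    apply le_antisymm
    · exact Finset.sup_le fun i _ => hmono.monotone (Fin.le_last i)
    · exact Finset.le_sup (f := d) (Finset.mem_univ _)
  have hD : 0 < Finset.univ.sup d := by rw [hsup]; exact hpos _
  have hdel : ∀ j : Fin (m+1), del d j.castSucc = d j := by
    intro j; simp only [del, Fin.val_castSucc, j.2, dite_true]
  have hdel' : del d (Fin.last (m+1)) = 0 := by simp [del]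
  have hex : ∀ j : Fin (m+1), (j : ℕ) < m → ∃ c, ¬ Uniq (wt d) (Finsupp.single j.castSucc c) ∧
      ∀ q, q < Finsupp.single j.castSucc c → Uniq (wt d) q := by
    intro j hj
    have hlt : d j < d (Fin.last m) := hmono (by rw [Fin.lt_def]; simpa using hj)
    have h0 : ¬ Uniq (wt d) (Finsupp.single j.castSucc (d (Fin.last m))) := by
      intro h
      have h1 := h (Finsupp.single (Fin.last m).castSucc (d j) +
        Finsupp.single (Fin.last (m+1)) (d (Fin.last m) - d j)) (by
          rw [dg_iff d hD, TT_add, NN_add]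
          simp only [TT_single, NN_single, hdel, hdel']
          constructor
          · ring
          · omega)
      have h2 := DFunLike.congr_fun h1 j.castSucc
      have h3 : (Fin.last m).castSucc ≠ j.castSucc := by
        intro h; have := congrArg Fin.val h; simp at this; omega
      have h4 : Fin.last (m+1) ≠ j.castSucc := by
        intro h; have := congrArg Fin.val h; simp at this; omega
      simp [h3] at h2
      have := hpos (Fin.last m); omega
    obtain ⟨v, hv, h1, h2⟩ := exists_min _ _ h0
    obtain ⟨c, rfl⟩ := le_single _ _ _ hv
    exact ⟨c, h1, h2⟩
  choose! c hc1 hc2 using hex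
  have hnl : ∀ j : Fin (m+1), j ≠ Fin.last m → (j : ℕ) < m := by
    intro j hj
    have := Fin.val_lt_last hj
    simpa using this
  refine main_count (k := k) (wt d) m g (by rw [← proj_eq]; exact hg)
    (fun j => if j = Fin.last m then u else Finsupp.single j.castSucc (c j)) ?_ ?_ ?_
  · intro i
    try dsimp only
    split_ifs with h
    · exact hu
    · exact hc1 i (hnl i h)
  · intro i
    try dsimp only
    split_ifs with h
    · exact hu'
    · exact hc2 i (hnl i h)
  · intro i j hij
    try dsimp only
    rw [Ne, dg_iff d hD]
    split_ifs with h1 h2 h2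
    · exact absurd (h1.trans h2.symm) hij
    · rintro ⟨hT, hN⟩
      rw [TT_single, hdel] at hT
      rw [NN_single] at hN
      exact hdeg j (hnl j h2) (by rw [hT, hN])
    · rintro ⟨hT, hN⟩
      rw [TT_single, hdel] at hT
      rw [NN_single] at hN
      exact hdeg i (hnl i h1) (by rw [← hT, ← hN])
    · rintro ⟨hT, hN⟩
      rw [TT_single, TT_single, hdel, hdel] at hT
      rw [NN_single, NN_single] at hN
      rw [hN] at hT
      have hcj : 0 < c j := by
        rcases Nat.eq_zero_or_pos (c j) with h | h
        · exfalso
          apply hc1 j (hnl j h2)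
          rw [h]
          intro v hv
          rw [dg_iff d hD] at hv
          obtain ⟨_, hN'⟩ := hv
          rw [NN_single] at hN'
          ext l
          have := le_NN v l
          simp; omega
        · exact h
      exact hij (hmono.injective (Nat.eq_of_mul_eq_mul_left hcj hT))

end specific

section cases
variable {k : Type*} [Field k] {m : ℕ}

lemma sup_pos (d : Fin (m+3) → ℕ) (hpos : ∀ i, 0 < d i) : 0 < Finset.univ.sup d :=
  lt_of_lt_of_le (hpos 0) (Finset.le_sup (f := d) (Finset.mem_univ _))

lemma del_inj (d : Fin (m+3) → ℕ) (hpos : ∀ i, 0 < d i) (hmono : StrictMono d) :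
    Function.Injective (del d) := by
  intro i j hij
  unfold del at hij
  split_ifs at hij with h1 h2 h2
  · have := congrArg Fin.val (hmono.injective hij)
    exact Fin.ext this
  · have := hpos ⟨i, h1⟩; omega
  · have := hpos ⟨j, h2⟩; omega
  · apply Fin.ext; omega

lemma case_h (d : Fin (m+3) → ℕ) (a h e : ℕ) (ha : 0 < a) (hh : 2 ≤ h) (he : 0 < e)
    (hpos : ∀ i, 0 < d i) (hmono : StrictMono d)
    (h0 : ∀ j : Fin (m+3), (j : ℕ) = 0 → d j = a)
    (hd : ∀ j : Fin (m+3), 0 < (j : ℕ) → d j = h * a + j * e) : ¬ ProjIsCI k d := by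
  have hD := sup_pos d hpos
  have hinj := del_inj d hpos hmono
  let x0 : Fin (m+3+1) := ⟨0, by omega⟩
  let x1 : Fin (m+3+1) := ⟨1, by omega⟩
  let x2 : Fin (m+3+1) := ⟨2, by omega⟩
  let y : Fin (m+3+1) := ⟨m+3, by omega⟩
  have e0 : del d x0 = a := by simp [del, x0]; exact h0 _ rfl
  have e1 : del d x1 = h * a + e := by simp [del, x1]; rw [hd _ (by simp)]; simp
  have e2 : del d x2 = h * a + 2 * e := by simp [del, x2]; rw [hd _ (by simp)]
  have ey : del d y = 0 := by simp [del, y]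
  have n01 : x0 ≠ x1 := by simp [x0, x1]
  have n02 : x0 ≠ x2 := by simp [x0, x2]
  have n12 : x1 ≠ x2 := by simp [x1, x2]
  have n0y : x0 ≠ y := by simp [x0, y]
  have n1y : x1 ≠ y := by simp [x1, y]
  have hnu : ¬ Uniq (wt d) (Finsupp.single x0 h + Finsupp.single x2 1) := by
    intro H
    have h1 := H (Finsupp.single x1 2 + Finsupp.single y (h-1)) (by
      rw [dg_iff d hD, TT_add, NN_add, TT_add, NN_add]
      simp only [TT_single, NN_single, e0, e1, e2, ey]
      constructor
      · ring
      · omega)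
    have h2 := DFunLike.congr_fun h1 x1
    simp [Finsupp.single_apply, n01, n12.symm, n1y.symm] at h2
  obtain ⟨u, hu, hu1, hu2⟩ := exists_min _ _ hnu
  obtain ⟨hi, hj, hueq⟩ := le_single2 u x0 x2 n02 _ _ hu
  generalize u x0 = i at *
  generalize u x2 = j at *
  have hj1 : j = 1 := by
    by_contra hj'
    have hj0 : j = 0 := by omega
    subst hj0
    apply hu1
    rw [hueq]
    intro v hv
    rw [Finsupp.single_zero, add_zero] at *
    rw [dg_iff d hD, TT_single, NN_single, e0] at hv
    obtain ⟨hT, hN⟩ := hv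
    have hz : ∀ l, l ≠ x0 → l ≠ y → v l = 0 := by
      intro l hl0 hly
      have hl0' : 0 < (l : ℕ) := by
        rcases Nat.eq_zero_or_pos (l : ℕ) with h | h
        · exact absurd (Fin.ext h) hl0
        · exact h
      have hly' : (l : ℕ) < m + 3 := by
        have : (l : ℕ) ≠ m + 3 := fun h => hly (Fin.ext h)
        omega
      have hle := le_TT d v l
      have hdl : del d l = h * a + l * e := by
        simp only [del, hly', dite_true]; exact hd _ hl0'
      by_contra hne
      have h3 : 1 ≤ v l := by omega
      have h4 : i * a ≤ h * a := Nat.mul_le_mul_right _ hi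
      have h5 : 0 < (l : ℕ) * e := Nat.mul_pos hl0' he
      have h6 : 1 * del d l ≤ v l * del d l := Nat.mul_le_mul_right _ h3
      omega
    have hv' : v = Finsupp.single x0 (v x0) + Finsupp.single y (v y) := by
      ext l
      by_cases hl0 : l = x0
      · subst hl0; simp [n0y.symm]
      · by_cases hly : l = y
        · subst hly; simp [n0y]
        · rw [hz l hl0 hly]; simp [Finsupp.single_apply, Ne.symm hl0, Ne.symm hly]
    rw [hv', TT_add, TT_single, TT_single, e0, ey, mul_zero, add_zero] at hT
    have h3 : v x0 = i := Nat.eq_of_mul_eq_mul_right ha hT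
    rw [hv', NN_add, NN_single, NN_single, h3] at hN
    have h4 : v y = 0 := by omega
    rw [hv', h3, h4, Finsupp.single_zero, add_zero]
  subst hj1
  have hi1 : 1 ≤ i := by
    by_contra hi'
    have hi0 : i = 0 := by omega
    subst hi0
    apply hu1
    apply uniq_small d hD hinj
    rw [hueq, NN_add, NN_single, NN_single]
  refine obstruct k d hpos hmono u hu1 hu2 ?_
  intro j hj
  rw [hueq, TT_add, NN_add]
  simp only [TT_single, NN_single, e0, e2]
  intro heq
  rcases Nat.lt_or_ge (j : ℕ) 1 with hj0 | hj0
  · rw [h0 j (by omega)] at heq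
    nlinarith
  · rw [hd j hj0] at heq
    have h1 : 2 * a ≤ h * a := Nat.mul_le_mul_right _ hh
    rcases Nat.lt_or_ge (j : ℕ) 2 with hj1 | hj1
    · have : (j : ℕ) = 1 := by omega
      rw [this] at heq
      nlinarith [Nat.mul_le_mul_left i h1, Nat.mul_le_mul_right e hi1]
    · have h2 : 2 * e ≤ j * e := Nat.mul_le_mul_right _ hj1
      nlinarith [Nat.mul_le_mul_left i h1, Nat.mul_le_mul_left i h2]

lemma case_4 (d : Fin (m+3) → ℕ) (a e : ℕ) (hm : 1 ≤ m) (he : 0 < e)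
    (hpos : ∀ i, 0 < d i) (hmono : StrictMono d)
    (hd : ∀ j : Fin (m+3), d j = a + j * e) : ¬ ProjIsCI k d := by
  have hD := sup_pos d hpos
  have hinj := del_inj d hpos hmono
  let x0 : Fin (m+3+1) := ⟨0, by omega⟩
  let x1 : Fin (m+3+1) := ⟨1, by omega⟩
  let x2 : Fin (m+3+1) := ⟨2, by omega⟩
  let x3 : Fin (m+3+1) := ⟨3, by omega⟩
  have e0 : del d x0 = a := by simp [del, x0, hd]
  have e1 : del d x1 = a + e := by simp [del, x1, hd]
  have e2 : del d x2 = a + 2 * e := by simp [del, x2, hd]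
  have e3 : del d x3 = a + 3 * e := by simp [del, x3, hd]; omega
  have n01 : x0 ≠ x1 := by simp [x0, x1]
  have n03 : x0 ≠ x3 := by simp [x0, x3]
  have n12 : x1 ≠ x2 := by simp [x1, x2]
  have n13 : x1 ≠ x3 := by simp [x1, x3]
  have hnu : ¬ Uniq (wt d) (Finsupp.single x0 1 + Finsupp.single x3 1) := by
    intro H
    have h1 := H (Finsupp.single x1 1 + Finsupp.single x2 1) (by
      rw [dg_iff d hD, TT_add, NN_add, TT_add, NN_add]
      simp only [TT_single, NN_single, e0, e1, e2, e3]
      constructor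
      · ring
      · trivial)
    have h2 := DFunLike.congr_fun h1 x1
    simp [Finsupp.single_apply, n01, n12.symm, n13.symm] at h2
  obtain ⟨u, hu, hu1, hu2⟩ := exists_min _ _ hnu
  obtain ⟨hi, hj, hueq⟩ := le_single2 u x0 x3 n03 _ _ hu
  have hN : ¬ NN u ≤ 1 := fun h => hu1 (uniq_small d hD hinj u h)
  generalize u x0 = i at *
  generalize u x3 = j at *
  have hN' := hN
  rw [hueq, NN_add, NN_single, NN_single] at hN'
  obtain rfl : i = 1 := by omega
  obtain rfl : j = 1 := by omega
  refine obstruct k d hpos hmono u hu1 hu2 ?_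
  intro j hj
  rw [hueq, TT_add, NN_add]
  simp only [TT_single, NN_single, e0, e3, hd]
  intro heq
  have : e * (2 * (j : ℕ)) = e * 3 := by linarith
  have := Nat.eq_of_mul_eq_mul_left he this
  omega

lemma TT4 (d : Fin 3 → ℕ) (u : Fin 4 →₀ ℕ) : TT (n := 3) d u =
    u 0 * del d 0 + u 1 * del d 1 + u 2 * del d 2 + u 3 * del d 3 :=
  Fin.sum_univ_four (fun i : Fin 4 => u i * del d i)

lemma NN4 (u : Fin 4 →₀ ℕ) : NN (n := 3) u = u 0 + u 1 + u 2 + u 3 :=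
  Fin.sum_univ_four (fun i : Fin 4 => u i)

lemma case_3 (d : Fin 3 → ℕ) (l e : ℕ) (he : 0 < e) (hco : Nat.Coprime (2*l+1) e)
    (hpos : ∀ i, 0 < d i) (hmono : StrictMono d)
    (hd : ∀ j : Fin 3, d j = (2*l+1) + j * e) : ¬ ProjIsCI k d := by
  have hD := sup_pos (m := 0) d hpos
  have hinj := del_inj (m := 0) d hpos hmono
  have e0 : del d 0 = 2*l+1 := by simp [del, hd]
  have e1 : del d 1 = 2*l+1 + e := by simp [del, hd]
  have e2 : del d 2 = 2*l+1 + 2 * e := by simp [del, hd]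
  have e3 : del d 3 = 0 := by simp [del]
  have hnu : ¬ Uniq (wt d) (Finsupp.single 0 (l+e) + Finsupp.single 1 1) := by
    intro H
    have h1 := H (Finsupp.single 2 (l+1) + Finsupp.single 3 e) (by
      rw [dg_iff d hD, TT_add, NN_add, TT_add, NN_add]
      simp only [TT_single, NN_single, e0, e1, e2, e3]
      constructor
      · ring
      · ring)
    have h2 := DFunLike.congr_fun h1 1
    simp at h2
  obtain ⟨u, hu, hu1, hu2⟩ := exists_min _ _ hnu
  obtain ⟨hi, hj, hueq⟩ := le_single2 u 0 1 (by decide) _ _ hu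
  generalize u 0 = i at *
  generalize u 1 = j at *
  have hj1 : j = 1 := by
    by_contra hj'
    obtain rfl : j = 0 := by omega
    apply hu1
    rw [hueq]
    intro v hv
    rw [Finsupp.single_zero, add_zero] at *
    rw [dg_iff d hD, TT_single, NN_single, e0] at hv
    obtain ⟨hT, hN⟩ := hv
    rw [TT4] at hT
    rw [NN4] at hN
    simp only [e0, e1, e2, e3] at hT
    obtain ⟨s, hs⟩ : ∃ s, i = v 0 + s := ⟨v 1 + v 2 + v 3, by omega⟩
    -- (2 s - b) a = (b + 2c) D
    have hsb : v 1 + v 2 + v 3 = s := by omega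
    have hkey : (v 1 + 2 * v 2 + 2 * v 3) * (2*l+1) = (v 1 + 2 * v 2) * (2*l+1+2*e) := by
      have : s * (2*l+1) = v 1 * (2*l+1+e) + v 2 * (2*l+1+2*e) := by
        rw [hs] at hT; linarith
      rw [← hsb] at this
      linarith
    have hco2 : Nat.Coprime (2*l+1+2*e) (2*l+1) := by
      have h1 : Nat.Coprime (2*l+1) (2*e) := by
        apply Nat.Coprime.mul_right _ hco
        simp
      have := (Nat.coprime_add_self_right (m := 2*l+1) (n := 2*e)).mpr h1
      rw [add_comm]
      exact this.symm
    have hdvd : (2*l+1+2*e) ∣ (v 1 + 2 * v 2 + 2 * v 3) :=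
      hco2.dvd_of_dvd_mul_right (Dvd.intro_left _ hkey.symm)
    obtain ⟨q, hq⟩ := hdvd
    have hq2 : v 1 + 2 * v 2 = q * (2*l+1) := by
      rw [hq] at hkey
      have : (2*l+1+2*e) * (v 1 + 2 * v 2) = (2*l+1+2*e) * (q * (2*l+1)) := by linarith
      exact Nat.eq_of_mul_eq_mul_left (by omega) this
    have hq0 : q = 0 := by
      by_contra hq0
      by_cases hq1 : q = 1
      · subst hq1
        omega
      · have : (2*l+1+2*e) * 2 ≤ (2*l+1+2*e) * q := Nat.mul_le_mul_left _ (by omega)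
        omega
    subst hq0
    ext t
    fin_cases t
    · show v 0 = _
      simp; omega
    · show v 1 = _
      simp; omega
    · show v 2 = _
      simp; omega
    · show v 3 = _
      simp; omega
  subst hj1
  have hi1 : 1 ≤ i := by
    by_contra hi'
    obtain rfl : i = 0 := by omega
    apply hu1
    apply uniq_small d hD hinj
    rw [hueq, NN_add, NN_single, NN_single]
  refine obstruct (m := 2) k d hpos hmono u hu1 hu2 ?_
  intro j hj
  rw [hueq, TT_add, NN_add]
  simp only [TT_single, NN_single, e0, e1, hd]
  intro heq
  obtain h | h : (j : ℕ) = 0 ∨ (j : ℕ) = 1 := by omega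
  · rw [h] at heq; nlinarith
  · rw [h] at heq; nlinarith

lemma case_ci (d : Fin 3 → ℕ) (p e : ℕ) (hp : 0 < p) (he : 0 < e) (hco : Nat.Coprime (2*p) e)
    (hpos : ∀ i, 0 < d i)
    (hd : ∀ j : Fin 3, d j = 2*p + j * e) : ProjIsCI k d := by
  have hD := sup_pos (m := 0) d hpos
  have e0 : del d 0 = 2*p := by simp [del, hd]
  have e1 : del d 1 = 2*p + e := by simp [del, hd]
  have e2 : del d 2 = 2*p + 2 * e := by simp [del, hd]
  have e3 : del d 3 = 0 := by simp [del]
  let g : Fin 2 → MvPolynomial (Fin 4) k :=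
    ![X 1 ^ 2 - X 0 * X 2, X 0 ^ (p+e) - X 2 ^ p * X 3 ^ e]
  refine ⟨g, ?_⟩
  rw [proj_eq]
  apply le_antisymm
  · rw [Ideal.span_le]
    rintro _ ⟨i, rfl⟩
    show (phi k (wt d)) _ = 0
    fin_cases i
    · show (phi k (wt d)) (X 1 ^ 2 - X 0 * X 2) = 0
      have h1 : (X 1 ^ 2 : MvPolynomial (Fin 4) k) = monomial (Finsupp.single 1 2) 1 := by
        rw [X_pow_eq_monomial]
      have h2 : (X 0 * X 2 : MvPolynomial (Fin 4) k) =
          monomial (Finsupp.single 0 1 + Finsupp.single 2 1) 1 := by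
        rw [X, X, monomial_mul, one_mul]
      rw [h1, h2, map_sub, phi_monomial, phi_monomial, sub_eq_zero]
      refine congrArg (fun b => MvPolynomial.monomial b (1 : k)) ?_
      rw [dg_iff d hD, TT_add, NN_add]
      simp only [TT_single, NN_single, e0, e1, e2]
      constructor
      · ring
      · trivial
    · show (phi k (wt d)) (X 0 ^ (p+e) - X 2 ^ p * X 3 ^ e) = 0
      have h1 : (X 0 ^ (p+e) : MvPolynomial (Fin 4) k) = monomial (Finsupp.single 0 (p+e)) 1 := by
        rw [X_pow_eq_monomial]
      have h2 : (X 2 ^ p * X 3 ^ e : MvPolynomial (Fin 4) k) =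
          monomial (Finsupp.single 2 p + Finsupp.single 3 e) 1 := by
        rw [X_pow_eq_monomial, X_pow_eq_monomial, monomial_mul, one_mul]
      rw [h1, h2, map_sub, phi_monomial, phi_monomial, sub_eq_zero]
      refine congrArg (fun b => MvPolynomial.monomial b (1 : k)) ?_
      rw [dg_iff d hD, TT_add, NN_add]
      simp only [TT_single, NN_single, e0, e2, e3]
      constructor
      · ring
      · trivial
  · apply ker_le
    set J := Ideal.span (Set.range g) with hJ
    let z : Fin 4 → MvPolynomial (Fin 4) k ⧸ J := fun i => Ideal.Quotient.mk J (X i)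
    have r1 : z 1 ^ 2 = z 0 * z 2 := by
      have : Ideal.Quotient.mk J (X 1 ^ 2 - X 0 * X 2) = 0 :=
        Ideal.Quotient.eq_zero_iff_mem.mpr (Ideal.subset_span ⟨0, rfl⟩)
      rw [map_sub, map_pow, map_mul, sub_eq_zero] at this
      exact this
    have r2 : z 0 ^ (p+e) = z 2 ^ p * z 3 ^ e := by
      have : Ideal.Quotient.mk J (X 0 ^ (p+e) - X 2 ^ p * X 3 ^ e) = 0 :=
        Ideal.Quotient.eq_zero_iff_mem.mpr (Ideal.subset_span ⟨1, rfl⟩)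
      rw [map_sub, map_pow, map_mul, map_pow, map_pow, sub_eq_zero] at this
      exact this
    have hmon : ∀ u : Fin 4 →₀ ℕ, Ideal.Quotient.mk J (monomial u 1) =
        z 0 ^ u 0 * z 1 ^ u 1 * z 2 ^ u 2 * z 3 ^ u 3 := by
      intro u
      rw [monomial_eq, Finsupp.prod_fintype _ _ (by simp), Fin.prod_univ_four]
      simp [z]
    have hnf : ∀ A B C E : ℕ, ∃ A' B' C' E' : ℕ, A' < p + e ∧ B' < 2 ∧
        z 0 ^ A * z 1 ^ B * z 2 ^ C * z 3 ^ E = z 0 ^ A' * z 1 ^ B' * z 2 ^ C' * z 3 ^ E' ∧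
        A * (2*p) + B * (2*p+e) + C * (2*p+2*e) = A' * (2*p) + B' * (2*p+e) + C' * (2*p+2*e) ∧
        A + B + C + E = A' + B' + C' + E' := by
      intro A B C E
      obtain ⟨b, B', hB', rfl⟩ : ∃ b B', B' < 2 ∧ B = 2 * b + B' :=
        ⟨B / 2, B % 2, Nat.mod_lt _ (by omega), (Nat.div_add_mod _ _).symm⟩
      obtain ⟨q, A', hA', hq⟩ : ∃ q A', A' < p + e ∧ A + b = (p+e) * q + A' :=
        ⟨(A+b) / (p+e), (A+b) % (p+e), Nat.mod_lt _ (by omega), (Nat.div_add_mod _ _).symm⟩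
      refine ⟨A', B', C + b + p * q, E + e * q, hA', hB', ?_, ?_, ?_⟩
      · calc z 0 ^ A * z 1 ^ (2*b+B') * z 2 ^ C * z 3 ^ E
            = z 0 ^ A * ((z 1 ^ 2) ^ b * z 1 ^ B') * z 2 ^ C * z 3 ^ E := by
              rw [pow_add, pow_mul]
          _ = z 0 ^ (A + b) * z 1 ^ B' * z 2 ^ (C+b) * z 3 ^ E := by
              rw [r1]; ring
          _ = ((z 0 ^ (p+e)) ^ q * z 0 ^ A') * z 1 ^ B' * z 2 ^ (C+b) * z 3 ^ E := by
              rw [hq, pow_add, pow_mul]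
          _ = _ := by rw [r2]; ring
      · have : A * (2*p) + b * (2 * p) = ((p+e) * q + A') * (2*p) := by rw [← hq]; ring
        nlinarith
      · nlinarith
    intro u v huv
    rw [dg_iff d hD] at huv
    obtain ⟨hT, hN⟩ := huv
    rw [TT4, TT4] at hT
    rw [NN4, NN4] at hN
    simp only [e0, e1, e2, e3, mul_zero, add_zero] at hT
    rw [hmon, hmon]
    obtain ⟨A, B, C, E, hA, hB, h1, h2, h3⟩ := hnf (u 0) (u 1) (u 2) (u 3)
    obtain ⟨A', B', C', E', hA', hB', h1', h2', h3'⟩ := hnf (v 0) (v 1) (v 2) (v 3)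
    rw [h1, h1']
    rw [h2, h2'] at hT
    rw [h3, h3'] at hN
    have hodd : e % 2 = 1 := by
      have h := Nat.Coprime.coprime_dvd_left (Dvd.intro p rfl) hco
      rw [Nat.coprime_two_left] at h
      exact Nat.odd_iff.mp h
    have hBB : B = B' := by
      have h4 : (B * e) % 2 = (B' * e) % 2 := by
        have : 2 * (A * p + B * p + C * (p+e)) + B * e =
          2 * (A' * p + B' * p + C' * (p+e)) + B' * e := by linarith
        omega
      rw [Nat.mul_mod, hodd, Nat.mul_mod B', hodd] at h4
      omega
    subst hBB
    have hT' : A * p + C * (p+e) = A' * p + C' * (p+e) := by linarith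
    have hco2 : Nat.Coprime (p+e) p := by
      have h := Nat.Coprime.coprime_dvd_left (Dvd.intro_left 2 rfl) hco
      rw [add_comm, Nat.coprime_add_self_left]
      exact h.symm
    have hAA : A = A' := by
      have h5 : A * p ≡ A' * p [MOD (p+e)] := by
        have h6 : (A * p + C * (p+e)) % (p+e) = (A' * p + C' * (p+e)) % (p+e) := by rw [hT']
        rw [Nat.add_mul_mod_self_right, Nat.add_mul_mod_self_right] at h6
        exact h6
      have h7 : A ≡ A' [MOD (p+e)] := Nat.ModEq.cancel_right_of_coprime hco2 h5
      exact h7.eq_of_lt_of_lt hA hA'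
    subst hAA
    have hCC : C = C' := by
      have : C * (p+e) = C' * (p+e) := by omega
      exact Nat.eq_of_mul_eq_mul_right (by omega) this
    subst hCC
    obtain rfl : E = E' := by omega
    rfl

end cases

end PT
/-- For a generalized arithmetic sequence `A = {d₁,…,dₙ}` of positive
integers with `n ≥ 3` and `gcd(A) = 1`, the projective toric ideal `I_{A*}` is a
complete intersection iff `n = 3`, `A` is an arithmetic sequence
(`d₂ − d₁ = d₃ − d₂`) and `d₁` is even. -/
theorem stmt6 (k : Type*) [Field k] (n : ℕ) (d : Fin n → ℕ)
    (hn : 3 ≤ n) (hpos : ∀ i, 0 < d i) (hga : IsGenArith d)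
    (hgcd : Finset.univ.gcd d = 1) :
    ProjIsCI k d ↔ n = 3 ∧
      d ⟨1, by omega⟩ - d ⟨0, by omega⟩ = d ⟨2, by omega⟩ - d ⟨1, by omega⟩ ∧
      Even (d ⟨0, by omega⟩) := by
  obtain ⟨m, rfl⟩ : ∃ m, n = m + 3 := ⟨n - 3, by omega⟩
  obtain ⟨h, e, hh, he, hd⟩ := hga
  obtain ⟨a, ha⟩ : ∃ a, d ⟨0, by omega⟩ = a := ⟨_, rfl⟩
  have hd' : ∀ j : Fin (m+3), 0 < (j : ℕ) → d j = h * a + j * e := by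
    intro j hj; rw [hd j hj, ← ha]
  have h0 : ∀ j : Fin (m+3), (j : ℕ) = 0 → d j = a := by
    intro j hj; rw [← ha]; congr 1; exact Fin.ext hj
  have hapos : 0 < a := ha ▸ hpos _
  have hmono : StrictMono d := by
    intro i j hij
    rw [Fin.lt_def] at hij
    rw [hd' j (by omega)]
    have h1 : ((i : ℕ) + 1) * e ≤ j * e := Nat.mul_le_mul_right _ hij
    rcases Nat.eq_zero_or_pos (i : ℕ) with hi | hi
    · rw [h0 i hi]
      have : 1 * a ≤ h * a := Nat.mul_le_mul_right _ hh
      rw [hi] at h1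
      omega
    · rw [hd' i hi]
      rw [add_mul] at h1
      omega
  have hco : Nat.Coprime a e := by
    have : Nat.gcd a e ∣ Finset.univ.gcd d := by
      apply Finset.dvd_gcd
      intro i _
      rcases Nat.eq_zero_or_pos (i : ℕ) with hi | hi
      · rw [h0 i hi]; exact Nat.gcd_dvd_left _ _
      · rw [hd' i hi]
        exact dvd_add (Dvd.dvd.mul_left (Nat.gcd_dvd_left _ _) _)
          (Dvd.dvd.mul_left (Nat.gcd_dvd_right _ _) _)
    rw [hgcd] at this
    exact Nat.dvd_one.mp this
  have hd1 : d ⟨1, by omega⟩ = h * a + e := by rw [hd' _ (by simp)]; simp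
  have hd2 : d ⟨2, by omega⟩ = h * a + 2 * e := by rw [hd' _ (by simp)]
  rw [hd1, hd2, ha]
  constructor
  · intro hci
    obtain rfl | hh2 : h = 1 ∨ 2 ≤ h := by omega
    · have hall : ∀ j : Fin (m+3), d j = a + j * e := by
        intro j
        rcases Nat.eq_zero_or_pos (j : ℕ) with hi | hi
        · rw [h0 j hi, hi]; simp
        · rw [hd' j hi]; simp
      by_cases hm : 1 ≤ m
      · exact absurd hci (PT.case_4 d a e hm he hpos hmono hall)
      · obtain rfl : m = 0 := by omega
        refine ⟨rfl, by omega, ?_⟩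
        by_contra hodd
        rw [Nat.not_even_iff_odd] at hodd
        obtain ⟨l, rfl⟩ := hodd
        exact PT.case_3 d l e he hco hpos hmono hall hci
    · exact absurd hci (PT.case_h d a h e hapos hh2 he hpos hmono h0 hd')
  · rintro ⟨hm, hdiff, hev⟩
    obtain rfl : m = 0 := by omega
    obtain ⟨p, rfl⟩ := even_iff_two_dvd.mp hev
    have hh1 : h = 1 := by
      have h1 : h * (2 * p) = 1 * (2 * p) := by
        have : 1 * (2 * p) ≤ h * (2 * p) := Nat.mul_le_mul_right _ hh
        omega
      exact Nat.eq_of_mul_eq_mul_right hapos h1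
    subst hh1
    refine PT.case_ci d p e (by omega) he hco hpos ?_
    intro j
    rcases Nat.eq_zero_or_pos (j : ℕ) with hi | hi
    · rw [h0 j hi, hi]; simp
    · rw [hd' j hi]; simp
end
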